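/- arXiv:2509.01358 — 3 statements merged into one kernel-verified Lean document; each statement's English description precedes it below -/
import Mathlib

section
/- In the one-dimensional setting, if Assumption 1 holds (for every player i and every profile g_{-i} of monotone pure strategies of the opponents, the interim payoff V_i(a_i, t_i; g_{-i}) has increasing differences in (a_i, t_i)), then the Bayesian game possesses a perfect monotone equilibrium. -/
/-!
Statement 0 (Theorem `thm-one dimensional`): In the one-dimensional setting, under
Assumption 1 (increasing differences of interim payoffs against monotone pure strategies
of the opponents), the Bayesian game possesses a perfect monotone equilibrium.
-/

open MeasureTheory Filter Metric

namespace MonotonePerfection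

noncomputable section

/-- The Prohorov (Lévy–Prokhorov) distance between two Borel measures. -/
def prohorovDist {Ω : Type*} [MeasurableSpace Ω] [PseudoMetricSpace Ω]
    (μ ν : Measure Ω) : ℝ :=
  sInf {ε : ℝ |
    ∀ B : Set Ω, MeasurableSet B →
      μ B ≤ ν (Metric.thickening ε B) + ENNReal.ofReal ε ∧
      ν B ≤ μ (Metric.thickening ε B) + ENNReal.ofReal ε}

/-- A mixed strategy: a measurable family of Borel probability measures on the action space. -/
def IsMixedStrategy {Y X : Type*} [MeasurableSpace Y] [MeasurableSpace X]
    (g : Y → Measure X) : Prop :=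
  (∀ t, IsProbabilityMeasure (g t)) ∧
  ∀ B : Set X, MeasurableSet B → Measurable fun t => g t B

/-- `h : X → Y → ℝ` has increasing differences in `(x, y)`. -/
def IncreasingDifferences {X Y : Type*} [Preorder X] [Preorder Y] (h : X → Y → ℝ) : Prop :=
  ∀ ⦃x x' : X⦄ ⦃y y' : Y⦄, x < x' → y < y' → h x' y - h x y ≤ h x' y' - h x y'

variable {n : ℕ} {A : Fin n → Type*} {T : Fin n → Type*}

section Defs

variable [∀ i, MeasurableSpace (A i)] [∀ i, MeasurableSpace (T i)]

/-- A completely mixed strategy profile: every nonempty open set of actions gets positive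
probability at every type. -/
def CompletelyMixed [∀ i, TopologicalSpace (A i)]
    (g : ∀ i, T i → Measure (A i)) : Prop :=
  ∀ (i : Fin n) (t : T i) (O : Set (A i)), IsOpen O → O.Nonempty → 0 < g i t O

/-- The interim payoff `V i (a, t; g₋ᵢ)` of player `i` of type `t` playing action `a` against
the mixed strategies `g` of the opponents (the `i`-th component of `g` is irrelevant, since the
`i`-th coordinates of the integrated profiles are overwritten by `a` and `t`);
`cond i t` is a version of the conditional distribution of the type profile given `t_i = t`. -/
def interim (u : ∀ _ : Fin n, (∀ j, A j) → (∀ j, T j) → ℝ)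
    (cond : ∀ i, T i → Measure (∀ j, T j))
    (i : Fin n) (a : A i) (t : T i) (g : ∀ j, T j → Measure (A j)) : ℝ :=
  ∫ s, ∫ b, u i (Function.update b i a) (Function.update s i t)
      ∂(Measure.pi fun j => g j (s j)) ∂(cond i t)

/-- The best responses of player `i` of type `t` against mixed strategies `g` of the others. -/
def BR (u : ∀ _ : Fin n, (∀ j, A j) → (∀ j, T j) → ℝ)
    (cond : ∀ i, T i → Measure (∀ j, T j))
    (i : Fin n) (t : T i) (g : ∀ j, T j → Measure (A j)) : Set (A i) :=
  {a | ∀ a', interim u cond i a' t g ≤ interim u cond i a t g}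

/-- A pure strategy profile viewed as a (Dirac) mixed strategy profile. -/
def diracProfile (g : ∀ i, T i → A i) : ∀ i, T i → Measure (A i) :=
  fun i t => Measure.dirac (g i t)

/-- Bayesian Nash equilibrium: almost every type plays a best response. -/
def IsBNE (u : ∀ _ : Fin n, (∀ j, A j) → (∀ j, T j) → ℝ)
    (cond : ∀ i, T i → Measure (∀ j, T j))
    (prior : Measure (∀ j, T j)) (g : ∀ i, T i → A i) : Prop :=
  ∀ i, ∀ᵐ t ∂(prior.map fun τ => τ i), g i t ∈ BR u cond i t (diracProfile g)

/-- A perfect pure strategy profile: there is a sequence of completely mixed strategy profiles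
approximating it in the Prohorov metric, against which the prescribed actions are asymptotically
best responses. -/
def IsPerfect [∀ i, MetricSpace (A i)]
    (u : ∀ _ : Fin n, (∀ j, A j) → (∀ j, T j) → ℝ)
    (cond : ∀ i, T i → Measure (∀ j, T j))
    (prior : Measure (∀ j, T j)) (g : ∀ i, T i → A i) : Prop :=
  ∃ gk : ℕ → ∀ i, T i → Measure (A i),
    (∀ k i, IsMixedStrategy (gk k i)) ∧
    (∀ k, CompletelyMixed (gk k)) ∧
    ∀ i, ∀ᵐ t ∂(prior.map fun τ => τ i),
      Tendsto (fun k => prohorovDist (gk k i t) (Measure.dirac (g i t))) atTop (nhds 0) ∧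
      Tendsto (fun k => infDist (g i t) (BR u cond i t (gk k))) atTop (nhds 0)

end Defs

/-! ### Scarf's combinatorial lemma -/

namespace Scarf

/-- Dominance of a finite set with respect to a family of rankings. -/
def Dom {V I : Type} (r : I → V → ℕ) (σ : Finset V) : Prop :=
  ∀ y, ∃ i, ∀ x ∈ σ, r i y ≤ r i x

theorem Dom.mono {V I : Type} {r : I → V → ℕ} {σ τ : Finset V} (h : Dom r σ) (hs : τ ⊆ σ) :
    Dom r τ := fun y => by
  obtain ⟨i, hi⟩ := h y
  exact ⟨i, fun x hx => hi x (hs hx)⟩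

/-- A ridge that is in a general position is contained in exactly two dominant facets. -/
theorem ridge_two {V I : Type} [Fintype V] [DecidableEq V] [Fintype I] [DecidableEq I]
    (r : I → V → ℕ) (hr : ∀ i, Function.Injective (r i)) (ρ : Finset V)
    (hcard : ρ.card + 1 = Fintype.card I) (hne : ρ.Nonempty) (hD : Dom r ρ)
    (hZ : ∀ i, ∃ z, ∀ k, k ≠ i → ∃ x ∈ ρ, r k x < r k z) :
    ∃ y₁ y₂, y₁ ∉ ρ ∧ y₂ ∉ ρ ∧ y₁ ≠ y₂ ∧ Dom r (insert y₁ ρ) ∧ Dom r (insert y₂ ρ) ∧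
      ∀ y, y ∉ ρ → Dom r (insert y ρ) → y = y₁ ∨ y = y₂ := by
  classical
  -- the minimum map
  have hmin : ∀ i, ∃ x ∈ ρ, ∀ x' ∈ ρ, r i x ≤ r i x' := fun i =>
    Finset.exists_min_image ρ (r i) hne
  choose m hm hmle using hmin
  have huniq : ∀ i x, x ∈ ρ → (∀ x' ∈ ρ, r i x ≤ r i x') → x = m i := by
    intro i x hx h
    exact hr i (le_antisymm (h _ (hm i)) (hmle i x hx))
  have himg : Finset.univ.image m = ρ := by
    ext x
    simp only [Finset.mem_image, Finset.mem_univ, true_and]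
    constructor
    · rintro ⟨i, rfl⟩; exact hm i
    · intro hx
      obtain ⟨i, hi⟩ := hD x
      exact ⟨i, (huniq i x hx hi).symm⟩
  -- collision
  have hni : ¬ Function.Injective m := by
    intro hinj
    have := Finset.card_image_of_injective Finset.univ hinj
    rw [himg, Finset.card_univ] at this
    omega
  obtain ⟨i, j, hij, hne'⟩ : ∃ i j, m i = m j ∧ i ≠ j := by
    simpa [Function.Injective] using hni
  have hinjE : ∀ a : I, a = i ∨ a = j → Set.InjOn m (Finset.univ.erase a : Finset I) := by
    intro a ha
    rw [← Finset.card_image_iff]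
    have : (Finset.univ.erase a).image m = ρ := by
      rw [← himg]
      ext x
      simp only [Finset.mem_image, Finset.mem_erase, Finset.mem_univ, and_true, true_and]
      constructor
      · rintro ⟨k, _, rfl⟩; exact ⟨k, rfl⟩
      · rintro ⟨k, rfl⟩
        by_cases hk : k = a
        · subst hk
          rcases ha with rfl | rfl
          · exact ⟨j, hne'.symm, hij.symm⟩
          · exact ⟨i, hne', hij⟩
        · exact ⟨k, hk, rfl⟩
    rw [this, Finset.card_erase_of_mem (Finset.mem_univ _), Finset.card_univ]
    omega
  -- candidates
  have hcand : ∀ a : I, ∃ y, (∀ k, k ≠ a → r k (m k) < r k y) ∧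
      ∀ z, (∀ k, k ≠ a → r k (m k) < r k z) → r a z ≤ r a y := by
    intro a
    have hne2 : (Finset.univ.filter fun z => ∀ k, k ≠ a → r k (m k) < r k z).Nonempty := by
      obtain ⟨z, hz⟩ := hZ a
      refine ⟨z, by
        simp only [Finset.mem_filter, Finset.mem_univ, true_and]
        intro k hk
        obtain ⟨x, hx, hlt⟩ := hz k hk
        exact lt_of_le_of_lt (hmle k x hx) hlt⟩
    obtain ⟨y, hy, hmax⟩ := Finset.exists_max_image _ (r a) hne2
    simp only [Finset.mem_filter, Finset.mem_univ, true_and] at hy hmax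
    exact ⟨y, hy, hmax⟩
  have key : ∀ a : I, a = i ∨ a = j → ∀ y, (∀ k, k ≠ a → r k (m k) < r k y) →
      (∀ z, (∀ k, k ≠ a → r k (m k) < r k z) → r a z ≤ r a y) →
      y ∉ ρ ∧ r a y < r a (m a) ∧ Dom r (insert y ρ) := by
    intro a ha y hy hmax
    have hyρ : y ∉ ρ := by
      intro hyρ
      rw [← himg] at hyρ
      obtain ⟨k, -, rfl⟩ := Finset.mem_image.1 hyρ
      by_cases hk : k = a
      · subst hk
        rcases ha with rfl | rfl
        · have := hy j hne'.symm
          rw [hij] at this; exact lt_irrefl _ this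
        · have := hy i hne'
          rw [hij] at this; exact lt_irrefl _ this
      · exact lt_irrefl _ (hy k hk)
    have hlt : r a y < r a (m a) := by
      obtain ⟨k, hk⟩ := hD y
      have hka : k = a := by
        by_contra hka
        exact absurd (hy k hka) (not_lt.2 (hk _ (hm k)))
      subst hka
      refine lt_of_le_of_ne (hk _ (hm k)) fun h => hyρ ?_
      rw [hr k h]; exact hm k
    refine ⟨hyρ, hlt, fun z => ?_⟩
    by_cases hz : ∀ k, k ≠ a → r k (m k) < r k z
    · refine ⟨a, fun x hx => ?_⟩
      rcases Finset.mem_insert.1 hx with rfl | hx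
      · exact hmax z hz
      · exact (hmax z hz).trans (hlt.le.trans (hmle a x hx))
    · push Not at hz
      obtain ⟨k, hk, hkz⟩ := hz
      refine ⟨k, fun x hx => ?_⟩
      rcases Finset.mem_insert.1 hx with rfl | hx
      · exact hkz.trans (hy k hk).le
      · exact hkz.trans (hmle k x hx)
  obtain ⟨y₁, hy₁, hy₁m⟩ := hcand i
  obtain ⟨y₂, hy₂, hy₂m⟩ := hcand j
  obtain ⟨h1a, h1b, h1c⟩ := key i (Or.inl rfl) y₁ hy₁ hy₁m
  obtain ⟨h2a, h2b, h2c⟩ := key j (Or.inr rfl) y₂ hy₂ hy₂m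
  refine ⟨y₁, y₂, h1a, h2a, ?_, h1c, h2c, ?_⟩
  · rintro rfl
    exact absurd h1b (not_lt.2 (hy₂ i hne').le)
  · intro y hy hDy
    -- y is minimal for some index
    obtain ⟨a, ha⟩ := hDy y
    have hay : r a y < r a (m a) := by
      refine lt_of_le_of_ne (ha _ (Finset.mem_insert_of_mem (hm a))) fun h => hy ?_
      rw [hr a h]; exact hm a
    -- each element of rho is still a minimizer for some index, different from a
    have hothers : ∀ k, ∃ l, l ≠ a ∧ m l = m k ∧ r l (m l) < r l y := by
      intro k
      obtain ⟨l, hl⟩ := hDy (m k)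
      have hlk : m k = m l := huniq l (m k) (hm k) fun x hx => hl x (Finset.mem_insert_of_mem hx)
      have hly := hl y (Finset.mem_insert_self _ _)
      rw [hlk] at hly
      refine ⟨l, ?_, hlk.symm, ?_⟩
      · rintro rfl; exact absurd hay (not_lt.2 hly)
      · refine lt_of_le_of_ne hly fun h => hy ?_
        rw [← hr l h]; exact hm l
    have haij : a = i ∨ a = j := by
      by_contra hcon
      push Not at hcon
      obtain ⟨l, hla, hlm, -⟩ := hothers a
      by_cases hli : l = i
      · have := hinjE j (Or.inr rfl) (x₁ := l) (x₂ := a) (by subst hli; simp [hne'])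
          (by simp [hcon.2]) hlm
        exact hla this
      · have := hinjE i (Or.inl rfl) (x₁ := l) (x₂ := a) (by simp [hli])
          (by simp [hcon.1]) hlm
        exact hla this
    have hgt : ∀ k, k ≠ a → r k (m k) < r k y := by
      intro k hk
      obtain ⟨l, hla, hlm, hl⟩ := hothers k
      have : l = k := hinjE a haij (x₁ := l) (x₂ := k) (by simp [hla]) (by simp [hk]) hlm
      rwa [← this]
    have hmax : ∀ z, (∀ k, k ≠ a → r k (m k) < r k z) → r a z ≤ r a y := by
      intro z hz
      obtain ⟨k, hk⟩ := hDy z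
      by_cases hka : k = a
      · subst hka; exact hk y (Finset.mem_insert_self _ _)
      · exact absurd (hz k hka) (not_lt.2 (hk _ (Finset.mem_insert_of_mem (hm k))))
    rcases haij with rfl | rfl
    · exact Or.inl (hr a (le_antisymm (hy₁m y hgt) (hmax y₁ hy₁)))
    · exact Or.inr (hr a (le_antisymm (hy₂m y hgt) (hmax y₂ hy₂)))

/-- The number of ridges of colour type `i₀` of a facet: one if the facet is rainbow,
even otherwise. -/
theorem facet_count {V I : Type} [DecidableEq V] [Fintype I] [DecidableEq I] [Fintype V]
    (c : V → I) (i₀ : I) (F : Finset V) (hF : F.card = Fintype.card I) :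
    ((((Finset.univ : Finset (Finset V)).filter fun ρ =>
      (ρ.card + 1 = Fintype.card I ∧ ρ.image c = Finset.univ.erase i₀) ∧ ρ ⊆ F).card : ℕ) : ZMod 2)
      = if F.image c = Finset.univ then 1 else 0 := by
  classical
  have herase : ∀ ρ : Finset V, ρ.card + 1 = Fintype.card I → ρ ⊆ F → ∃ v ∈ F, ρ = F.erase v := by
    intro ρ h1 h2
    obtain ⟨v, hv⟩ : (F \ ρ).Nonempty := by
      rw [← Finset.card_pos, Finset.card_sdiff_of_subset h2]; omega
    rw [Finset.mem_sdiff] at hv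
    refine ⟨v, hv.1, Finset.eq_of_subset_of_card_le ?_ ?_⟩
    · intro x hx
      exact Finset.mem_erase.2 ⟨fun h => hv.2 (h ▸ hx), h2 hx⟩
    · rw [Finset.card_erase_of_mem hv.1]; omega
  split_ifs with hrb
  · have hinj : Set.InjOn c F := by
      rw [← Finset.card_image_iff, hrb, Finset.card_univ, hF]
    obtain ⟨v, hv, hvc⟩ : ∃ v ∈ F, c v = i₀ := by
      have : i₀ ∈ F.image c := by rw [hrb]; simp
      simpa using this
    have : ((Finset.univ : Finset (Finset V)).filter fun ρ =>
      (ρ.card + 1 = Fintype.card I ∧ ρ.image c = Finset.univ.erase i₀) ∧ ρ ⊆ F) = {F.erase v} := by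
      ext ρ
      simp only [Finset.mem_filter, Finset.mem_univ, true_and, Finset.mem_singleton]
      constructor
      · rintro ⟨⟨h1, h2⟩, h3⟩
        obtain ⟨w, hw, rfl⟩ := herase ρ h1 h3
        by_cases hwv : w = v
        · rw [hwv]
        · exfalso
          have : i₀ ∈ (F.erase w).image c :=
            Finset.mem_image.2 ⟨v, Finset.mem_erase.2 ⟨fun h => hwv h.symm, hv⟩, hvc⟩
          rw [h2] at this
          simp at this
      · rintro rfl
        refine ⟨⟨?_, ?_⟩, Finset.erase_subset _ _⟩
        · rw [Finset.card_erase_of_mem hv, hF]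
          have : 0 < F.card := Finset.card_pos.2 ⟨v, hv⟩
          omega
        · ext k
          simp only [Finset.mem_image, Finset.mem_erase, Finset.mem_univ, and_true]
          constructor
          · rintro ⟨x, ⟨hxv, hx⟩, rfl⟩ h
            exact hxv (hinj hx hv (h.trans hvc.symm))
          · intro hk
            have : k ∈ F.image c := by rw [hrb]; simp
            obtain ⟨x, hx, rfl⟩ := Finset.mem_image.1 this
            exact ⟨x, ⟨fun h => hk (by rw [h, hvc]), hx⟩, rfl⟩
    rw [this]; simp
  · by_cases hemp : ((Finset.univ : Finset (Finset V)).filter fun ρ =>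
      (ρ.card + 1 = Fintype.card I ∧ ρ.image c = Finset.univ.erase i₀) ∧ ρ ⊆ F) = ∅
    · rw [hemp]; simp
    · obtain ⟨ρ, hρ⟩ := Finset.nonempty_iff_ne_empty.2 hemp
      simp only [Finset.mem_filter, Finset.mem_univ, true_and] at hρ
      obtain ⟨⟨h1, h2⟩, h3⟩ := hρ
      obtain ⟨v, hv, rfl⟩ := herase ρ h1 h3
      have hcv : c v ≠ i₀ := by
        intro h
        apply hrb
        rw [← Finset.insert_erase hv, Finset.image_insert, h2, h,
          Finset.insert_erase (Finset.mem_univ _)]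
      have : c v ∈ (F.erase v).image c := by rw [h2]; simp [hcv]
      obtain ⟨w, hw, hwc⟩ := Finset.mem_image.1 this
      have hwv : w ≠ v := (Finset.mem_erase.1 hw).1
      have hwF : w ∈ F := (Finset.mem_erase.1 hw).2
      have hinj : Set.InjOn c (F.erase v : Finset V) := by
        rw [← Finset.card_image_iff, h2, Finset.card_erase_of_mem (Finset.mem_univ _),
          Finset.card_univ]
        omega
      have himF : F.image c = Finset.univ.erase i₀ := by
        rw [← h2]
        ext k
        simp only [Finset.mem_image, Finset.mem_erase]
        constructor
        · rintro ⟨x, hx, rfl⟩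
          by_cases hxv : x = v
          · exact ⟨w, ⟨hwv, hwF⟩, by rw [hwc, hxv]⟩
          · exact ⟨x, ⟨hxv, hx⟩, rfl⟩
        · rintro ⟨x, ⟨-, hx⟩, rfl⟩; exact ⟨x, hx, rfl⟩
      have : ((Finset.univ : Finset (Finset V)).filter fun ρ =>
        (ρ.card + 1 = Fintype.card I ∧ ρ.image c = Finset.univ.erase i₀) ∧ ρ ⊆ F)
          = {F.erase v, F.erase w} := by
        ext ρ
        simp only [Finset.mem_filter, Finset.mem_univ, true_and, Finset.mem_singleton,
          Finset.mem_insert]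
        constructor
        · rintro ⟨⟨k1, k2⟩, k3⟩
          obtain ⟨x, hx, rfl⟩ := herase ρ k1 k3
          by_cases hxv : x = v
          · left; rw [hxv]
          right
          have hcx : c x ∈ (F.erase x).image c := by
            rw [k2, ← himF]; exact Finset.mem_image_of_mem _ hx
          obtain ⟨x', hx', hxc⟩ := Finset.mem_image.1 hcx
          rw [Finset.mem_erase] at hx'
          have hx'v : x' = v := by
            by_contra h
            exact hx'.1 (hinj (by simp [h, hx'.2]) (by simp [hxv, hx]) hxc)
          have : x = w := hinj (by simp [hxv, hx]) (by simp [hwv, hwF])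
            (by rw [← hxc, hx'v, hwc])
          rw [this]
        · rintro (rfl | rfl)
          · exact ⟨⟨h1, h2⟩, h3⟩
          · refine ⟨⟨?_, ?_⟩, Finset.erase_subset _ _⟩
            · rw [Finset.card_erase_of_mem hwF]
              rw [Finset.card_erase_of_mem hv] at h1
              exact h1
            · rw [← himF]
              ext k
              simp only [Finset.mem_image, Finset.mem_erase]
              constructor
              · rintro ⟨x, ⟨-, hx⟩, rfl⟩; exact ⟨x, hx, rfl⟩
              · rintro ⟨x, hx, rfl⟩
                by_cases hxw : x = w
                · exact ⟨v, ⟨hwv.symm, hv⟩, by rw [← hwc, hxw]⟩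
                · exact ⟨x, ⟨hxw, hx⟩, rfl⟩
      have hne : F.erase v ≠ F.erase w := by
        intro h
        have : v ∈ F.erase w := Finset.mem_erase.2 ⟨hwv.symm, hv⟩
        rw [← h] at this
        simp at this
      rw [this, Finset.card_pair hne]
      rfl

/-- Rankings on `T ⊕ I`, where the elements of `I` are slack elements. -/
structure Slack {T I : Type} (r : I → T ⊕ I → ℕ) : Prop where
  inj : ∀ i, Function.Injective (r i)
  low : ∀ i t, r i (Sum.inr i) < r i (Sum.inl t)
  high : ∀ i j t, j ≠ i → r i (Sum.inl t) < r i (Sum.inr j)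

theorem insert_of_subset {V : Type} [DecidableEq V] {ρ F : Finset V} {N : ℕ}
    (h1 : ρ.card + 1 = N) (h2 : F.card = N) (h : ρ ⊆ F) : ∃ y, y ∉ ρ ∧ F = insert y ρ := by
  obtain ⟨v, hv⟩ : (F \ ρ).Nonempty := by
    rw [← Finset.card_pos, Finset.card_sdiff_of_subset h]; omega
  rw [Finset.mem_sdiff] at hv
  refine ⟨v, hv.2, (Finset.eq_of_subset_of_card_le ?_ ?_).symm⟩
  · intro x hx
    rcases Finset.mem_insert.1 hx with rfl | hx
    · exact hv.1
    · exact h hx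
  · rw [Finset.card_insert_of_notMem hv.2]; omega

/-- **Scarf's lemma.** -/
theorem scarf {T I : Type} [Fintype T] [DecidableEq T] [Fintype I] [DecidableEq I] [Nonempty I]
    [Nonempty T] (r : I → T ⊕ I → ℕ) (hr : Slack r) (c : T → I) :
    ∃ F : Finset (T ⊕ I), Dom r F ∧ F.image (Sum.elim c id) = Finset.univ := by
  classical
  obtain ⟨i₀⟩ := (inferInstance : Nonempty I)
  set cc : T ⊕ I → I := Sum.elim c id with hcc
  set Rg : Finset (Finset (T ⊕ I)) := Finset.univ.filter fun ρ =>
    ρ.card + 1 = Fintype.card I ∧ ρ.image cc = Finset.univ.erase i₀ with hRg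
  set Fc : Finset (Finset (T ⊕ I)) := Finset.univ.filter fun F =>
    F.card = Fintype.card I ∧ Dom r F with hFc
  set ρ₀ : Finset (T ⊕ I) := (Finset.univ.erase i₀).image Sum.inr with hρ₀
  have hdc := Finset.sum_card_bipartiteAbove_eq_sum_card_bipartiteBelow
    (s := Rg) (t := Fc) (fun ρ F => ρ ⊆ F)
  have hNpos : 0 < Fintype.card I := Fintype.card_pos
  have hρ₀card : ρ₀.card + 1 = Fintype.card I := by
    rw [hρ₀, Finset.card_image_of_injective _ Sum.inr_injective,
      Finset.card_erase_of_mem (Finset.mem_univ _), Finset.card_univ]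
    omega
  have hρ₀mem : ρ₀ ∈ Rg := by
    simp only [hRg, Finset.mem_filter, Finset.mem_univ, true_and]
    refine ⟨hρ₀card, ?_⟩
    rw [hρ₀, Finset.image_image]
    ext k; simp [hcc]
  -- ridges
  have hridge : ∀ ρ ∈ Rg, (((Fc.filter fun F => ρ ⊆ F).card : ℕ) : ZMod 2) =
      if ρ = ρ₀ then 1 else 0 := by
    intro ρ hρ
    simp only [hRg, Finset.mem_filter, Finset.mem_univ, true_and] at hρ
    split_ifs with h0
    · -- the special ridge
      subst h0
      obtain ⟨y, -, hy⟩ := Finset.exists_max_image (Finset.univ : Finset T)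
        (fun t => r i₀ (Sum.inl t)) Finset.univ_nonempty
      have hynot : (Sum.inl y : T ⊕ I) ∉ ρ₀ := by simp [hρ₀]
      have : (Fc.filter fun F => ρ₀ ⊆ F) = {insert (Sum.inl y) ρ₀} := by
        ext F
        simp only [hFc, Finset.mem_filter, Finset.mem_univ, true_and, Finset.mem_singleton]
        constructor
        · rintro ⟨⟨hF1, hF2⟩, hF3⟩
          obtain ⟨v, hv, rfl⟩ := insert_of_subset hρ₀card hF1 hF3
          rcases v with t | k
          · -- t is the maximum
            obtain ⟨k, hk⟩ := hF2 (Sum.inl y)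
            have hk0 : k = i₀ := by
              by_contra hk0
              have := hk (Sum.inr k) (by simp [hρ₀, hk0])
              exact absurd (hr.low k y) (not_lt.2 this)
            subst hk0
            have h1 := hk (Sum.inl t) (Finset.mem_insert_self _ _)
            have h2 := hy t (Finset.mem_univ _)
            rw [hr.inj k (le_antisymm h1 h2)]
          · exfalso
            have hk0 : k = i₀ := by
              by_contra hk0
              apply hv
              simp [hρ₀, hk0]
            subst hk0
            obtain ⟨l, hl⟩ := hF2 (Sum.inl y)
            have := hl (Sum.inr l) (by
              simp only [hρ₀, Finset.mem_insert, Finset.mem_image, Finset.mem_erase]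
              by_cases hlk : l = k
              · left; rw [hlk]
              · right; exact ⟨l, ⟨hlk, Finset.mem_univ _⟩, rfl⟩)
            exact absurd (hr.low l y) (not_lt.2 this)
        · rintro rfl
          refine ⟨⟨?_, ?_⟩, Finset.subset_insert _ _⟩
          · rw [Finset.card_insert_of_notMem hynot, hρ₀card]
          · intro z
            by_cases hz : ∃ l, l ≠ i₀ ∧ z = Sum.inr l
            · obtain ⟨l, hl, rfl⟩ := hz
              refine ⟨l, fun x hx => ?_⟩
              rcases x with t | k
              · exact (hr.low l t).le
              · by_cases hkl : k = l
                · rw [hkl]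
                · exact ((hr.low l y).trans (hr.high l k y hkl)).le
            · refine ⟨i₀, fun x hx => ?_⟩
              have hzy : r i₀ z ≤ r i₀ (Sum.inl y) := by
                rcases z with t | k
                · exact hy t (Finset.mem_univ _)
                · have : k = i₀ := by
                    by_contra h
                    exact hz ⟨k, h, rfl⟩
                  rw [this]; exact (hr.low i₀ y).le
              refine hzy.trans ?_
              rcases Finset.mem_insert.1 hx with rfl | hx
              · exact le_rfl
              · simp only [hρ₀, Finset.mem_image, Finset.mem_erase] at hx
                obtain ⟨k, ⟨hk, -⟩, rfl⟩ := hx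
                exact (hr.high i₀ k y hk).le
      rw [this]; simp
    · by_cases hemp : (Fc.filter fun F => ρ ⊆ F) = ∅
      · rw [hemp]; simp
      obtain ⟨F, hF⟩ := Finset.nonempty_iff_ne_empty.2 hemp
      simp only [hFc, Finset.mem_filter, Finset.mem_univ, true_and] at hF
      have hDρ : Dom r ρ := hF.1.2.mono hF.2
      have hT : ∃ t, (Sum.inl t : T ⊕ I) ∈ ρ := by
        by_contra hT
        push Not at hT
        apply h0
        refine Finset.eq_of_subset_of_card_le ?_ (by omega)
        intro x hx
        rcases x with t | k
        · exact absurd hx (hT t)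
        · have : k ∈ ρ.image cc := Finset.mem_image.2 ⟨_, hx, rfl⟩
          rw [hρ.2] at this
          exact Finset.mem_image.2 ⟨k, this, rfl⟩
      obtain ⟨t, ht⟩ := hT
      obtain ⟨y₁, y₂, hy₁, hy₂, hne, hD₁, hD₂, hall⟩ := ridge_two r hr.inj ρ hρ.1 ⟨_, ht⟩ hDρ
        (fun i => ⟨Sum.inr i, fun k hk => ⟨_, ht, hr.high k i t hk.symm⟩⟩)
      have : (Fc.filter fun F => ρ ⊆ F) = {insert y₁ ρ, insert y₂ ρ} := by
        ext F'
        simp only [hFc, Finset.mem_filter, Finset.mem_univ, true_and, Finset.mem_singleton,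
          Finset.mem_insert]
        constructor
        · rintro ⟨⟨hF1, hF2⟩, hF3⟩
          obtain ⟨v, hv, rfl⟩ := insert_of_subset hρ.1 hF1 hF3
          rcases hall v hv hF2 with rfl | rfl
          · left; rfl
          · right; rfl
        · rintro (rfl | rfl)
          · exact ⟨⟨by rw [Finset.card_insert_of_notMem hy₁, hρ.1], hD₁⟩, Finset.subset_insert _ _⟩
          · exact ⟨⟨by rw [Finset.card_insert_of_notMem hy₂, hρ.1], hD₂⟩, Finset.subset_insert _ _⟩
      have hne2 : insert y₁ ρ ≠ insert y₂ ρ := by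
        intro h
        have : y₁ ∈ insert y₂ ρ := by rw [← h]; exact Finset.mem_insert_self _ _
        rcases Finset.mem_insert.1 this with h | h
        · exact hne h
        · exact hy₁ h
      rw [this, Finset.card_pair hne2]; rfl
  have hfacet : ∀ F ∈ Fc, (((Rg.filter fun ρ => ρ ⊆ F).card : ℕ) : ZMod 2) =
      if F.image cc = Finset.univ then 1 else 0 := by
    intro F hF
    simp only [hFc, Finset.mem_filter, Finset.mem_univ, true_and] at hF
    rw [← facet_count cc i₀ F hF.1, hRg, Finset.filter_filter]
  have hcast := congrArg (fun k : ℕ => (k : ZMod 2)) hdc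
  simp only [Finset.bipartiteAbove, Finset.bipartiteBelow, Nat.cast_sum] at hcast
  rw [Finset.sum_congr rfl hridge, Finset.sum_congr rfl hfacet, Finset.sum_ite_eq' Rg ρ₀,
    if_pos hρ₀mem] at hcast
  by_contra hcon
  push Not at hcon
  rw [Finset.sum_eq_zero] at hcast
  · exact one_ne_zero hcast
  · intro F hF
    simp only [hFc, Finset.mem_filter, Finset.mem_univ, true_and] at hF
    rw [if_neg (hcon F hF.2)]

end Scarf
/-! ### Brouwer's fixed point theorem -/

namespace Scarf

theorem grid_step {I : Type} [Fintype I] [DecidableEq I] [Nonempty I]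
    (G : (I → ℝ) → (I → ℝ)) (hpos : ∀ x i, 0 ≤ G x i) (hsum : ∀ x, ∑ i, G x i = 1)
    (k : ℕ) (hk : 0 < k) :
    ∃ x ∈ stdSimplex ℝ I, ∀ i, ∃ z : I → ℝ, (∀ j, |z j - x j| ≤ (Fintype.card I : ℝ) / k) ∧
      z i - (Fintype.card I : ℝ) / k ≤ G z i := by
  classical
  set N := Fintype.card I with hN
  let T : Type := ↥(Finset.piAntidiag (Finset.univ : Finset I) k)
  have hTsum : ∀ t : T, ∑ i, t.1 i = k := fun t => (Finset.mem_piAntidiag.1 t.2).1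
  have hTle : ∀ (t : T) i, t.1 i ≤ k := fun t i => by
    have h := Finset.single_le_sum (f := t.1) (fun _ _ => Nat.zero_le _) (Finset.mem_univ i)
    exact h.trans (hTsum t).le
  have mkT : ∀ y : I → ℕ, ∑ i, y i = k → ∃ t : T, t.1 = y := fun y hy =>
    ⟨⟨y, Finset.mem_piAntidiag.2 ⟨hy, fun _ _ => Finset.mem_univ _⟩⟩, rfl⟩
  have : Nonempty T := by
    obtain ⟨i⟩ := (inferInstance : Nonempty I)
    obtain ⟨t, -⟩ := mkT (Pi.single i k) (by simp)
    exact ⟨t⟩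
  set M := Fintype.card T with hM
  have hMpos : 0 < M := Fintype.card_pos
  let e : T → ℕ := fun t => (Fintype.equivFin T t : ℕ)
  have he : ∀ t, e t < M := fun t => (Fintype.equivFin T t).2
  have heinj : Function.Injective e := fun a b h => (Fintype.equivFin T).injective (Fin.ext h)
  let e' : I → ℕ := fun t => (Fintype.equivFin I t : ℕ)
  have heinj' : Function.Injective e' := fun a b h => (Fintype.equivFin I).injective (Fin.ext h)
  let r : I → T ⊕ I → ℕ := fun i => Sum.elim (fun t => (t.1 i + 1) * M + e t)
    (fun j => if j = i then 0 else (k + 2) * M + e' j)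
  have hrl : ∀ i t, r i (Sum.inl t) = (t.1 i + 1) * M + e t := fun _ _ => rfl
  have hrr : ∀ i j, r i (Sum.inr j) = if j = i then 0 else (k + 2) * M + e' j := fun _ _ => rfl
  have hlt : ∀ i t, r i (Sum.inl t) < (k + 2) * M := by
    intro i t
    rw [hrl]
    have h1 := he t
    have h2 := hTle t i
    calc (t.1 i + 1) * M + e t < (t.1 i + 1) * M + M := by omega
      _ = (t.1 i + 2) * M := by ring
      _ ≤ (k + 2) * M := Nat.mul_le_mul_right _ (by omega)
  have hgt : ∀ i t, 0 < r i (Sum.inl t) := by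
    intro i t
    rw [hrl]
    positivity
  have hslack : Slack r := by
    refine ⟨?_, ?_, ?_⟩
    · intro i a b hab
      rcases a with a | a <;> rcases b with b | b
      · rw [hrl, hrl] at hab
        have : e a = e b := by
          have := congrArg (· % M) hab
          simpa [Nat.mul_add_mod', Nat.mod_eq_of_lt (he _)] using this
        rw [heinj this]
      · have h1 := hlt i a
        have h2 := hgt i a
        rw [hab, hrr] at h1 h2
        split_ifs at h1 h2 <;> omega
      · have h1 := hlt i b
        have h2 := hgt i b
        rw [← hab, hrr] at h1 h2
        split_ifs at h1 h2 <;> omega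
      · rw [hrr, hrr] at hab
        have : 0 < (k + 2) * M := by positivity
        split_ifs at hab with h1 h2 h2
        · rw [h1, h2]
        · omega
        · omega
        · rw [heinj' (Nat.add_left_cancel hab)]
    · intro i t
      have := hgt i t
      rw [hrr, if_pos rfl]; exact this
    · intro i j t hj
      have := hlt i t
      rw [hrr, if_neg hj]; omega
  have hrle : ∀ i (t t' : T), r i (Sum.inl t) ≤ r i (Sum.inl t') → t.1 i ≤ t'.1 i := by
    intro i t t' h
    by_contra hcon
    push Not at hcon
    rw [hrl, hrl] at h
    have h1 := he t'
    have : (t'.1 i + 2) * M ≤ (t.1 i + 1) * M := Nat.mul_le_mul_right _ (by omega)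
    have h3 : (t'.1 i + 2) * M = (t'.1 i + 1) * M + M := by ring
    omega
  have hkR : (0 : ℝ) < k := by exact_mod_cast hk
  let p : T → I → ℝ := fun t i => (t.1 i : ℝ) / k
  have hpsum : ∀ t, ∑ i, p t i = 1 := by
    intro t
    simp only [p]
    rw [← Finset.sum_div, ← Nat.cast_sum, hTsum t, div_self hkR.ne']
  have hpS : ∀ t, p t ∈ stdSimplex ℝ I := fun t => ⟨fun i => by positivity, hpsum t⟩
  have hcol : ∀ t : T, ∃ i, p t i ≤ G (p t) i := by
    intro t
    have := Finset.exists_le_of_sum_le (s := (Finset.univ : Finset I)) (f := p t) (g := G (p t))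
      Finset.univ_nonempty (by rw [hpsum, hsum])
    obtain ⟨i, -, hi⟩ := this
    exact ⟨i, hi⟩
  choose c hc using hcol
  obtain ⟨F, hF, hFc⟩ := scarf r hslack c
  have hdom : ∀ y : T, ∃ j, Sum.inr j ∉ F ∧ ∀ t, Sum.inl t ∈ F → y.1 j ≤ t.1 j := by
    intro y
    obtain ⟨j, hj⟩ := hF (Sum.inl y)
    refine ⟨j, fun h => ?_, fun t ht => hrle j y t (hj _ ht)⟩
    exact absurd (hslack.low j y) (not_lt.2 (hj _ h))
  have hcolF : ∀ j, Sum.inr j ∉ F → ∃ t, Sum.inl t ∈ F ∧ c t = j := by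
    intro j hj
    have : j ∈ F.image (Sum.elim c id) := by rw [hFc]; simp
    obtain ⟨x, hx, hxj⟩ := Finset.mem_image.1 this
    rcases x with t | l
    · exact ⟨t, hx, hxj⟩
    · simp only [Sum.elim_inr, id] at hxj
      subst hxj; exact absurd hx hj
  obtain ⟨j₀, hj₀, -⟩ := hdom (Classical.arbitrary T)
  obtain ⟨t₀, ht₀, -⟩ := hcolF j₀ hj₀
  have hmin : ∀ j, ∃ t : T, Sum.inl t ∈ F ∧ ∀ t', Sum.inl t' ∈ F → t.1 j ≤ t'.1 j := by
    intro j
    obtain ⟨t, ht, h⟩ := Finset.exists_min_image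
      (Finset.univ.filter fun t : T => (Sum.inl t : T ⊕ I) ∈ F) (fun t => t.1 j)
      ⟨t₀, by simp [ht₀]⟩
    simp only [Finset.mem_filter, Finset.mem_univ, true_and] at ht h
    exact ⟨t, ht, h⟩
  choose μ hμF hμ using hmin
  let m : I → ℕ := fun j => if Sum.inr j ∈ F then 0 else (μ j).1 j
  have hmle : ∀ t, Sum.inl t ∈ F → ∀ j, m j ≤ t.1 j := by
    intro t ht j
    simp only [m]
    split_ifs
    · exact Nat.zero_le _
    · exact hμ j t ht
  have hbig : k < ∑ j, m j + N := by
    by_contra hcon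
    push Not at hcon
    let y₁ : I → ℕ := fun j => if Sum.inr j ∈ F then 0 else (μ j).1 j + 1
    have hy₁ : ∑ j, y₁ j ≤ k := by
      refine le_trans ?_ hcon
      calc ∑ j, y₁ j ≤ ∑ j, (m j + 1) := by
            refine Finset.sum_le_sum fun j _ => ?_
            simp only [y₁, m]
            split_ifs <;> omega
        _ = ∑ j, m j + N := by rw [Finset.sum_add_distrib]; simp [hN]
    obtain ⟨y, hy⟩ := mkT (fun j => y₁ j + if j = j₀ then k - ∑ j, y₁ j else 0) (by
      rw [Finset.sum_add_distrib, Finset.sum_ite_eq' Finset.univ j₀]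
      simp only [Finset.mem_univ, if_true]
      omega)
    obtain ⟨j, hj, hjt⟩ := hdom y
    have h1 := hjt _ (hμF j)
    have h2 : y₁ j ≤ y.1 j := by rw [hy]; exact Nat.le_add_right _ _
    have h3 : y₁ j = (μ j).1 j + 1 := by simp only [y₁]; rw [if_neg hj]
    omega
  have hupper : ∀ t, Sum.inl t ∈ F → ∀ j, t.1 j ≤ m j + N := by
    intro t ht j
    have h1 : ∑ l, t.1 l = k := hTsum t
    have h2 : ∑ l ∈ Finset.univ.erase j, m l ≤ ∑ l ∈ Finset.univ.erase j, t.1 l :=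
      Finset.sum_le_sum fun l _ => hmle t ht l
    have h3 := Finset.add_sum_erase Finset.univ (fun l => t.1 l) (Finset.mem_univ j)
    have h4 := Finset.add_sum_erase Finset.univ m (Finset.mem_univ j)
    omega
  have hclose : ∀ t t' : T, Sum.inl t ∈ F → Sum.inl t' ∈ F → ∀ j, |p t j - p t' j| ≤ (N : ℝ) / k := by
    intro t t' ht ht' j
    have h1 := hmle t ht j
    have h2 := hmle t' ht' j
    have h3 := hupper t ht j
    have h4 := hupper t' ht' j
    have h5 : (t.1 j : ℝ) ≤ t'.1 j + N := by exact_mod_cast (by omega : t.1 j ≤ t'.1 j + N)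
    have h6 : (t'.1 j : ℝ) ≤ t.1 j + N := by exact_mod_cast (by omega : t'.1 j ≤ t.1 j + N)
    simp only [p]
    rw [← sub_div, abs_div, abs_of_pos hkR]
    gcongr
    rw [abs_le]
    constructor <;> linarith
  refine ⟨p t₀, hpS t₀, fun i => ?_⟩
  by_cases hi : Sum.inr i ∈ F
  · refine ⟨p t₀, fun j => hclose _ _ ht₀ ht₀ j, ?_⟩
    have h1 := hupper t₀ ht₀ i
    have h2 : m i = 0 := by simp only [m]; rw [if_pos hi]
    have h3 : (t₀.1 i : ℝ) ≤ N := by exact_mod_cast (by omega : t₀.1 i ≤ N)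
    have h4 : p t₀ i ≤ (N : ℝ) / k := by simp only [p]; gcongr
    have := hpos (p t₀) i
    linarith
  · obtain ⟨t, ht, hct⟩ := hcolF i hi
    refine ⟨p t, fun j => hclose _ _ ht ht₀ j, ?_⟩
    have := hc t
    rw [hct] at this
    have h5 : (0 : ℝ) ≤ (N : ℝ) / k := by positivity
    linarith

theorem brouwer_simplex {I : Type} [Fintype I] [DecidableEq I] [Nonempty I]
    (G : (I → ℝ) → (I → ℝ)) (hG : Continuous G)
    (hpos : ∀ x i, 0 ≤ G x i) (hsum : ∀ x, ∑ i, G x i = 1) :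
    ∃ x, G x = x := by
  have h := fun k : ℕ => grid_step G hpos hsum (k + 1) (Nat.succ_pos k)
  choose x hx z hz hzG using h
  obtain ⟨x', hx', φ, hφ, hlim⟩ := (isCompact_stdSimplex ℝ I).tendsto_subseq hx
  have hN : Tendsto (fun k : ℕ => (Fintype.card I : ℝ) / ((φ k + 1 : ℕ) : ℝ)) atTop (nhds 0) := by
    have h1 : Tendsto (fun k : ℕ => (Fintype.card I : ℝ) / (k : ℝ)) atTop (nhds 0) :=
      tendsto_const_div_atTop_nhds_zero_nat _
    exact h1.comp ((tendsto_add_atTop_nat 1).comp hφ.tendsto_atTop)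
  have hzl : ∀ i, Tendsto (fun k => z (φ k) i) atTop (nhds x') := by
    intro i
    rw [tendsto_pi_nhds]
    intro j
    have h1 : Tendsto (fun k => x (φ k) j) atTop (nhds (x' j)) := (tendsto_pi_nhds.1 hlim) j
    have h2 : Tendsto (fun k => z (φ k) i j - x (φ k) j) atTop (nhds 0) :=
      squeeze_zero_norm (fun k => hz (φ k) i j) hN
    simpa using h2.add h1
  have hge : ∀ i, x' i ≤ G x' i := by
    intro i
    have h1 : Tendsto (fun k => z (φ k) i i - (Fintype.card I : ℝ) / ((φ k + 1 : ℕ) : ℝ))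
        atTop (nhds (x' i - 0)) := ((tendsto_pi_nhds.1 (hzl i)) i).sub hN
    have h2 : Tendsto (fun k => G (z (φ k) i) i) atTop (nhds (G x' i)) :=
      (tendsto_pi_nhds.1 ((hG.tendsto x').comp (hzl i))) i
    have := le_of_tendsto_of_tendsto' h1 h2 (fun k => hzG (φ k) i)
    simpa using this
  refine ⟨x', funext fun i => ?_⟩
  have := (Finset.sum_eq_sum_iff_of_le (s := Finset.univ) (f := x') (g := G x')
    (fun i _ => hge i)).1 (by rw [hsum, hx'.2])
  exact (this i (Finset.mem_univ i)).symm

/-- Brouwer's fixed point theorem for maps with values in a cube. -/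
theorem brouwer_cube {ι : Type} [Fintype ι] (F : (ι → ℝ) → (ι → ℝ)) (hF : Continuous F)
    (h0 : ∀ x i, 0 ≤ F x i) (h1 : ∀ x i, F x i ≤ 1) : ∃ x, F x = x := by
  classical
  set N : ℝ := Fintype.card ι + 1 with hN
  have hNpos : 0 < N := by positivity
  let S : (Option ι → ℝ) → (ι → ℝ) := fun x i => N * x (some i)
  have hS : Continuous S := by fun_prop
  let G : (Option ι → ℝ) → (Option ι → ℝ) := fun x o =>
    o.elim (1 - ∑ i, F (S x) i / N) (fun i => F (S x) i / N)
  have hFS : Continuous fun x => F (S x) := hF.comp hS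
  have hFS' : ∀ i, Continuous fun x => F (S x) i := fun i => (continuous_apply i).comp hFS
  obtain ⟨x, hx⟩ := brouwer_simplex G
    (by
      refine continuous_pi fun o => ?_
      rcases o with _ | i
      · simp only [G, Option.elim]
        exact continuous_const.sub (continuous_finsetSum _ fun i _ => (hFS' i).div_const _)
      · simp only [G, Option.elim]
        exact (hFS' i).div_const _)
    (by
      intro x o
      rcases o with _ | i
      · simp only [G, Option.elim]
        have : ∑ i, F (S x) i / N ≤ ∑ _i : ι, 1 / N :=
          Finset.sum_le_sum fun i _ => by gcongr; exact h1 _ _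
        have h2 : ∑ _i : ι, 1 / N ≤ 1 := by
          simp only [Finset.sum_const, Finset.card_univ, nsmul_eq_mul, hN]
          rw [mul_one_div, div_le_one (by positivity)]
          linarith
        linarith
      · simp only [G, Option.elim]
        exact div_nonneg (h0 _ _) hNpos.le)
    (by
      intro x
      rw [Fintype.sum_option]
      simp [G])
  refine ⟨S x, funext fun i => ?_⟩
  have := congrFun hx (some i)
  simp only [G, Option.elim] at this
  simp only [S]
  rw [← this]
  field_simp
  rfl

end Scarf
/-! ### Helly's selection theorem for profiles -/

theorem countable_subseq {ι : Type} [Countable ι] {X : ι → Type} [∀ i, TopologicalSpace (X i)]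
    [∀ i, FirstCountableTopology (X i)] [∀ i, CompactSpace (X i)] (x : ℕ → ∀ i, X i) :
    ∃ φ : ℕ → ℕ, StrictMono φ ∧ ∃ y : ∀ i, X i, ∀ i,
      Tendsto (fun m => x (φ m) i) atTop (nhds (y i)) := by
  obtain ⟨y, φ, hφ, h⟩ := CompactSpace.tendsto_subseq x
  exact ⟨φ, hφ, y, fun i => (tendsto_pi_nhds.1 h) i⟩

theorem helly_selection {n : ℕ} {T : Fin n → Type} [∀ i, LinearOrder (T i)]
    [∀ i, TopologicalSpace (T i)] [∀ i, OrderTopology (T i)] [∀ i, DenselyOrdered (T i)]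
    [∀ i, SecondCountableTopology (T i)] {S : Fin n → Set ℝ} [∀ i, CompactSpace ↥(S i)]
    (g : ℕ → ∀ i, T i → ↥(S i)) (hg : ∀ m i, Monotone (g m i)) :
    ∃ φ : ℕ → ℕ, StrictMono φ ∧ ∃ G : ∀ i, T i → ↥(S i), (∀ i, Monotone (G i)) ∧
      ∀ i t, Tendsto (fun m => g (φ m) i t) atTop (nhds (G i t)) := by
  classical
  have hQ : ∀ i, ∃ s : Set (T i), s.Countable ∧ Dense s ∧ (∀ x, IsBot x → x ∈ s) ∧
      ∀ x, IsTop x → x ∈ s := fun i => exists_countable_dense_bot_top (T i)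
  choose Q hQc hQd hQb hQt using hQ
  have : ∀ i, Countable ↥(Q i) := fun i => (hQc i).to_subtype
  obtain ⟨φ₁, hφ₁, h, hh⟩ := countable_subseq (ι := Σ i, ↥(Q i)) (X := fun p => ↥(S p.1))
    (fun m p => g m p.1 p.2.1)
  have hlim : ∀ i t, ∃ x : ↥(S i), Tendsto (fun m => g (φ₁ m) i t) (hyperfilter ℕ : Filter ℕ)
      (nhds x) := fun i t =>
    ⟨_, Ultrafilter.le_nhds_lim ((hyperfilter ℕ).map fun m => g (φ₁ m) i t)⟩
  choose G₁ hG₁ using hlim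
  have hG₁m : ∀ i, Monotone fun t => (G₁ i t : ℝ) := by
    intro i s t hst
    have h1 := (continuous_subtype_val.tendsto _).comp (hG₁ i s)
    have h2 := (continuous_subtype_val.tendsto _).comp (hG₁ i t)
    exact le_of_tendsto_of_tendsto' h1 h2 fun m => hg _ i hst
  have hQlim : ∀ i, ∀ d ∈ Q i, Tendsto (fun m => (g (φ₁ m) i d : ℝ)) atTop (nhds (G₁ i d : ℝ)) := by
    intro i d hd
    have h1 := hh ⟨i, ⟨d, hd⟩⟩
    have h2 : Tendsto (fun m => g (φ₁ m) i d) (hyperfilter ℕ : Filter ℕ) (nhds (h ⟨i, ⟨d, hd⟩⟩)) :=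
      h1.mono_left Nat.hyperfilter_le_atTop
    rw [tendsto_nhds_unique (hG₁ i d) h2]
    exact (continuous_subtype_val.tendsto _).comp h1
  have hgood : ∀ i t, ContinuousAt (fun t => (G₁ i t : ℝ)) t →
      Tendsto (fun m => (g (φ₁ m) i t : ℝ)) atTop (nhds (G₁ i t : ℝ)) := by
    intro i t hc
    by_cases htQ : t ∈ Q i
    · exact hQlim i t htQ
    have hnb : ∃ a, a < t := by
      by_contra hcon; push Not at hcon
      exact htQ (hQb i t hcon)
    have hnt : ∃ a, t < a := by
      by_contra hcon; push Not at hcon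
      exact htQ (hQt i t hcon)
    rw [tendsto_order]
    constructor
    · intro a ha
      have hev := hc.eventually (lt_mem_nhds ha)
      obtain ⟨l, hl, hlt⟩ := exists_Ioc_subset_of_mem_nhds hev hnb
      obtain ⟨d, hd, hdQ⟩ := (hQd i).exists_between hl
      have h1 : a < G₁ i d := hlt ⟨hdQ.1, hdQ.2.le⟩
      filter_upwards [(hQlim i d hd).eventually (lt_mem_nhds h1)] with m hm
      exact lt_of_lt_of_le hm (hg _ i hdQ.2.le)
    · intro a ha
      have hev := hc.eventually (gt_mem_nhds ha)
      obtain ⟨l, hl, hlt⟩ := exists_Ico_subset_of_mem_nhds hev hnt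
      obtain ⟨d, hd, hdQ⟩ := (hQd i).exists_between hl
      have h1 : (G₁ i d : ℝ) < a := hlt ⟨hdQ.1.le, hdQ.2⟩
      filter_upwards [(hQlim i d hd).eventually (gt_mem_nhds h1)] with m hm
      exact lt_of_le_of_lt (hg _ i hdQ.1.le) hm
  have hE : ∀ i, ({t | ¬ ContinuousAt (fun t => (G₁ i t : ℝ)) t} : Set (T i)).Countable :=
    fun i => (hG₁m i).countable_not_continuousAt
  have : ∀ i, Countable ↥({t | ¬ ContinuousAt (fun t => (G₁ i t : ℝ)) t} : Set (T i)) :=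
    fun i => (hE i).to_subtype
  obtain ⟨φ₂, hφ₂, h₂, hh₂⟩ := countable_subseq
    (ι := Σ i, ↥({t | ¬ ContinuousAt (fun t => (G₁ i t : ℝ)) t} : Set (T i)))
    (X := fun p => ↥(S p.1)) (fun m p => g (φ₁ m) p.1 p.2.1)
  have hall : ∀ i t, ∃ x : ↥(S i), Tendsto (fun m => g (φ₁ (φ₂ m)) i t) atTop (nhds x) := by
    intro i t
    by_cases hc : ContinuousAt (fun t => (G₁ i t : ℝ)) t
    · refine ⟨G₁ i t, ?_⟩
      rw [tendsto_subtype_rng]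
      exact (hgood i t hc).comp hφ₂.tendsto_atTop
    · exact ⟨_, hh₂ ⟨i, ⟨t, hc⟩⟩⟩
  choose G hG using hall
  refine ⟨φ₁ ∘ φ₂, hφ₁.comp hφ₂, G, ?_, hG⟩
  intro i s t hst
  have h1 := (continuous_subtype_val.tendsto _).comp (hG i s)
  have h2 := (continuous_subtype_val.tendsto _).comp (hG i t)
  have h3 : (G i s : ℝ) ≤ G i t := le_of_tendsto_of_tendsto' h1 h2 fun m => hg _ i hst
  exact h3
/-! ### The game: pure and perturbed payoffs -/

section Game

set_option linter.unusedSectionVars false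

variable {n : ℕ} {T : Fin n → Type} [∀ i, LinearOrder (T i)] [∀ i, TopologicalSpace (T i)]
  [∀ i, OrderTopology (T i)] [∀ i, SecondCountableTopology (T i)] [∀ i, MeasurableSpace (T i)]
  [∀ i, BorelSpace (T i)] {S : Fin n → Set ℝ}

/-- Interim payoff against a pure profile. -/
def pureV (u : ∀ _ : Fin n, (∀ j, ↥(S j)) → (∀ j, T j) → ℝ)
    (cond : ∀ i, T i → Measure (∀ j, T j))
    (i : Fin n) (a : ↥(S i)) (t : T i) (g : ∀ j, T j → ↥(S j)) : ℝ :=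
  ∫ s, u i (Function.update (fun j => g j (s j)) i a) (Function.update s i t) ∂(cond i t)

/-- Either the prescribed action (at `0`) or one of the trembles. -/
def mixA {α : Type} (x : α) (d : ℕ → α) : ℕ → α
  | 0 => x
  | r + 1 => d r

/-- The perturbed strategy profile. -/
def hatP (d : ∀ j, ℕ → ↥(S j)) (ν : Measure ℕ) (g : ∀ j, T j → ↥(S j)) :
    ∀ j, T j → Measure ↥(S j) :=
  fun j s => Measure.map (mixA (g j s) (d j)) ν

/-- A realization of the perturbed profile. -/
def mixP (d : ∀ j, ℕ → ↥(S j)) (g : ∀ j, T j → ↥(S j)) (ω : Fin n → ℕ) : ∀ j, T j → ↥(S j) :=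
  fun j s => mixA (g j s) (d j) (ω j)

/-- Interim payoff against a perturbed profile. -/
def mixV (u : ∀ _ : Fin n, (∀ j, ↥(S j)) → (∀ j, T j) → ℝ)
    (cond : ∀ i, T i → Measure (∀ j, T j)) (d : ∀ j, ℕ → ↥(S j)) (ν : Measure ℕ)
    (i : Fin n) (a : ↥(S i)) (t : T i) (g : ∀ j, T j → ↥(S j)) : ℝ :=
  ∫ ω, pureV u cond i a t (mixP d g ω) ∂(Measure.pi fun _ : Fin n => ν)

/-- The standing assumptions. -/
structure GameHyp (u : ∀ _ : Fin n, (∀ j, ↥(S j)) → (∀ j, T j) → ℝ)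
    (cond : ∀ i, T i → Measure (∀ j, T j)) (prior : Measure (∀ j, T j)) (M : ℝ) : Prop where
  prob : IsProbabilityMeasure prior
  bdd : ∀ i a t, |u i a t| ≤ M
  meas : ∀ i, Measurable fun p : (∀ j, ↥(S j)) × (∀ j, T j) => u i p.1 p.2
  cont : ∀ i t, Continuous fun a => u i a t
  condprob : ∀ i t, IsProbabilityMeasure (cond i t)
  condnull : ∀ i s, MeasurableSet s → prior s = 0 → ∀ᵐ t ∂(prior.map fun τ => τ i), cond i t s = 0
  atomless : ∀ i x, (prior.map fun τ => τ i) {x} = 0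
  incr : ∀ i (g : ∀ j, T j → ↥(S j)), (∀ j, Monotone (g j)) →
    IncreasingDifferences fun (a : ↥(S i)) (t : T i) => pureV u cond i a t g

theorem mono_measurable {X : Type} [LinearOrder X] [TopologicalSpace X] [OrderTopology X]
    [SecondCountableTopology X] [MeasurableSpace X] [BorelSpace X] {s : Set ℝ} {g : X → ↥s}
    (hg : Monotone g) : Measurable g := by
  have h : Monotone fun x => (g x : ℝ) := fun x y hxy => hg hxy
  exact h.measurable.subtype_mk

theorem mixP_mono (d : ∀ j, ℕ → ↥(S j)) {g : ∀ j, T j → ↥(S j)} (hg : ∀ j, Monotone (g j))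
    (ω : Fin n → ℕ) (j : Fin n) : Monotone (mixP d g ω j) := by
  intro s t hst
  simp only [mixP]
  cases ω j with
  | zero => exact hg j hst
  | succ r => exact le_rfl

variable {u : ∀ _ : Fin n, (∀ j, ↥(S j)) → (∀ j, T j) → ℝ}
  {cond : ∀ i, T i → Measure (∀ j, T j)} {prior : Measure (∀ j, T j)} {M : ℝ}

theorem measurable_payoff (H : GameHyp u cond prior M) (i : Fin n) (a : ↥(S i)) (t : T i)
    {Ω : Type} [MeasurableSpace Ω] {b : Ω → ∀ j, ↥(S j)} (hb : Measurable b)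
    {s : Ω → ∀ j, T j} (hs : Measurable s) :
    Measurable fun x => u i (Function.update (b x) i a) (Function.update (s x) i t) := by
  have h1 : Measurable fun x => Function.update (b x) i a := by
    refine measurable_pi_iff.2 fun j => ?_
    by_cases hj : j = i
    · subst hj; simp
    · simp only [Function.update_of_ne hj]
      exact (measurable_pi_apply j).comp hb
  have h2 : Measurable fun x => Function.update (s x) i t := by
    refine measurable_pi_iff.2 fun j => ?_
    by_cases hj : j = i
    · subst hj; simp
    · simp only [Function.update_of_ne hj]
      exact (measurable_pi_apply j).comp hs
  exact (H.meas i).comp (h1.prodMk h2)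

theorem profile_meas {g : ∀ j, T j → ↥(S j)} (hg : ∀ j, Monotone (g j)) :
    Measurable fun (s : ∀ j, T j) j => g j (s j) :=
  measurable_pi_iff.2 fun j => (mono_measurable (hg j)).comp (measurable_pi_apply j)

theorem pureV_bdd (H : GameHyp u cond prior M) (i : Fin n) (a : ↥(S i)) (t : T i)
    (g : ∀ j, T j → ↥(S j)) : |pureV u cond i a t g| ≤ M := by
  have := H.condprob i t
  have h := norm_integral_le_of_norm_le_const (μ := cond i t) (C := M)
    (f := fun s => u i (Function.update (fun j => g j (s j)) i a) (Function.update s i t))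
    (Eventually.of_forall fun s => H.bdd i _ _)
  simpa [pureV] using h

theorem interim_dirac (i : Fin n) (a : ↥(S i)) (t : T i)
    {g : ∀ j, T j → ↥(S j)} :
    interim u cond i a t (diracProfile g) = pureV u cond i a t g := by
  simp only [interim, pureV, diracProfile]
  congr 1
  ext s
  have : (Measure.pi fun j => Measure.dirac (g j (s j))) = Measure.dirac fun j => g j (s j) := by
    refine Measure.pi_eq fun A hA => ?_
    rw [Measure.dirac_apply' _ (MeasurableSet.univ_pi hA)]
    simp only [Measure.dirac_apply' _ (hA _)]
    by_cases h : ∀ j, g j (s j) ∈ A j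
    · rw [Set.indicator_of_mem (by simpa using h)]
      simp [h]
    · rw [Set.indicator_of_notMem (by simpa using h)]
      push Not at h
      obtain ⟨j, hj⟩ := h
      rw [Finset.prod_eq_zero (Finset.mem_univ j)]
      simp [hj]
  rw [this]
  rw [integral_dirac]

theorem interim_hat (H : GameHyp u cond prior M) (d : ∀ j, ℕ → ↥(S j)) (ν : Measure ℕ)
    [IsProbabilityMeasure ν] (i : Fin n) (a : ↥(S i)) (t : T i)
    {g : ∀ j, T j → ↥(S j)} (hg : ∀ j, Monotone (g j)) :
    interim u cond i a t (hatP d ν g) = mixV u cond d ν i a t g := by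
  have := H.condprob i t
  have hin : ∀ s : ∀ j, T j,
      ∫ b, u i (Function.update b i a) (Function.update s i t)
        ∂(Measure.pi fun j => hatP d ν g j (s j)) =
      ∫ ω, u i (Function.update (fun j => mixP d g ω j (s j)) i a) (Function.update s i t)
        ∂(Measure.pi fun _ : Fin n => ν) := by
    intro s
    have hm : ∀ j, Measurable (mixA (g j (s j)) (d j)) := fun j => measurable_from_top
    have : ∀ j, IsProbabilityMeasure (Measure.map (mixA (g j (s j)) (d j)) ν) :=
      fun j => Measure.isProbabilityMeasure_map (hm j).aemeasurable
    have h1 : (Measure.pi fun j => hatP d ν g j (s j)) =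
        Measure.map (fun (ω : Fin n → ℕ) j => mixA (g j (s j)) (d j) (ω j))
          (Measure.pi fun _ : Fin n => ν) := by
      rw [Measure.pi_map_pi fun j => (hm j).aemeasurable]
      rfl
    rw [h1, integral_map]
    · rfl
    · exact (measurable_pi_iff.2 fun j => (hm j).comp (measurable_pi_apply j)).aemeasurable
    · exact (measurable_payoff H i a t measurable_id
        (measurable_const (a := s))).aestronglyMeasurable
  simp only [interim, mixV, pureV]
  simp only [hin]
  rw [integral_integral_swap]
  have hmeas : Measurable fun p : (∀ j, T j) × (Fin n → ℕ) =>
      u i (Function.update (fun j => mixP d g p.2 j (p.1 j)) i a) (Function.update p.1 i t) := by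
    refine measurable_payoff H i a t ?_ measurable_fst
    refine measurable_pi_iff.2 fun j => ?_
    refine measurable_from_prod_countable_left fun ω => ?_
    exact (mono_measurable (mixP_mono d hg ω j)).comp (measurable_pi_apply j)
  refine Integrable.of_bound hmeas.aestronglyMeasurable M (Eventually.of_forall fun p => ?_)
  exact H.bdd i _ _

theorem mixV_integrable (H : GameHyp u cond prior M) (d : ∀ j, ℕ → ↥(S j)) (ν : Measure ℕ)
    [IsProbabilityMeasure ν] (i : Fin n) (a : ↥(S i)) (t : T i) (g : ∀ j, T j → ↥(S j)) :
    Integrable (fun ω => pureV u cond i a t (mixP d g ω)) (Measure.pi fun _ : Fin n => ν) :=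
  Integrable.of_bound (Measurable.of_discrete).aestronglyMeasurable M
    (Eventually.of_forall fun _ => pureV_bdd H i a t _)

theorem mixV_incr (H : GameHyp u cond prior M) (d : ∀ j, ℕ → ↥(S j)) (ν : Measure ℕ)
    [IsProbabilityMeasure ν] (i : Fin n) {g : ∀ j, T j → ↥(S j)} (hg : ∀ j, Monotone (g j)) :
    IncreasingDifferences fun (a : ↥(S i)) (t : T i) => mixV u cond d ν i a t g := by
  intro a a' t t' ha ht
  simp only [mixV]
  rw [← integral_sub (mixV_integrable H d ν i _ _ g) (mixV_integrable H d ν i _ _ g),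
    ← integral_sub (mixV_integrable H d ν i _ _ g) (mixV_integrable H d ν i _ _ g)]
  refine integral_mono ((mixV_integrable H d ν i _ _ g).sub (mixV_integrable H d ν i _ _ g))
    ((mixV_integrable H d ν i _ _ g).sub (mixV_integrable H d ν i _ _ g)) fun ω => ?_
  exact H.incr i (mixP d g ω) (mixP_mono d hg ω) ha ht

theorem pureV_tendsto (H : GameHyp u cond prior M) (i : Fin n) (t : T i)
    {g : ℕ → ∀ j, T j → ↥(S j)} (hg : ∀ m j, Monotone (g m j)) {G : ∀ j, T j → ↥(S j)}
    (hlim : ∀ᵐ s ∂(cond i t), ∀ j, Tendsto (fun m => g m j (s j)) atTop (nhds (G j (s j))))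
    {a : ℕ → ↥(S i)} {b : ↥(S i)} (ha : Tendsto a atTop (nhds b)) :
    Tendsto (fun m => pureV u cond i (a m) t (g m)) atTop (nhds (pureV u cond i b t G)) := by
  have := H.condprob i t
  refine tendsto_integral_of_dominated_convergence (fun _ => M) ?_ (integrable_const _) ?_ ?_
  · intro m
    exact (measurable_payoff H i (a m) t (profile_meas (hg m)) measurable_id).aestronglyMeasurable
  · intro m
    exact Eventually.of_forall fun s => H.bdd i _ _
  · filter_upwards [hlim] with s hs
    refine ((H.cont i (Function.update s i t)).tendsto _).comp ?_
    have h1 : Tendsto (fun m j => g m j (s j)) atTop (nhds fun j => G j (s j)) :=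
      tendsto_pi_nhds.2 hs
    exact h1.update i ha

theorem mixV_tendsto (H : GameHyp u cond prior M) (d : ∀ j, ℕ → ↥(S j)) (ν : Measure ℕ)
    [IsProbabilityMeasure ν] (i : Fin n) (t : T i)
    {g : ℕ → ∀ j, T j → ↥(S j)} (hg : ∀ m j, Monotone (g m j)) {G : ∀ j, T j → ↥(S j)}
    (hlim : ∀ᵐ s ∂(cond i t), ∀ j, Tendsto (fun m => g m j (s j)) atTop (nhds (G j (s j))))
    {a : ℕ → ↥(S i)} {b : ↥(S i)} (ha : Tendsto a atTop (nhds b)) :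
    Tendsto (fun m => mixV u cond d ν i (a m) t (g m)) atTop (nhds (mixV u cond d ν i b t G)) := by
  refine tendsto_integral_of_dominated_convergence (fun _ => M) ?_ (integrable_const _) ?_ ?_
  · intro m
    exact (mixV_integrable H d ν i _ _ _).aestronglyMeasurable
  · intro m
    exact Eventually.of_forall fun s => pureV_bdd H i _ _ _
  · refine Eventually.of_forall fun ω => ?_
    refine pureV_tendsto H i t (fun m j => mixP_mono d (hg m) ω j) ?_ ha
    filter_upwards [hlim] with s hs j
    simp only [mixP]
    cases ω j with
    | zero => exact hs j
    | succ r => exact tendsto_const_nhds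

theorem mixV_sub_le (H : GameHyp u cond prior M) (d : ∀ j, ℕ → ↥(S j)) (ν : Measure ℕ)
    [IsProbabilityMeasure ν] (i : Fin n) (a : ↥(S i)) (t : T i) (g : ∀ j, T j → ↥(S j)) :
    |mixV u cond d ν i a t g - pureV u cond i a t g| ≤ 2 * M * (1 - (ν.real {0}) ^ n) := by
  classical
  set π := Measure.pi fun _ : Fin n => ν with hπ
  have h0 : π.real {fun _ => 0} = (ν.real {0}) ^ n := by
    rw [measureReal_def, hπ, Measure.pi_singleton]
    simp [measureReal_def]
  have h1 : mixV u cond d ν i a t g - pureV u cond i a t g =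
      ∫ ω, (pureV u cond i a t (mixP d g ω) - pureV u cond i a t g) ∂π := by
    rw [integral_sub (mixV_integrable H d ν i _ _ g) (integrable_const _)]
    simp [mixV]
  have hM : 0 ≤ M := (abs_nonneg _).trans (pureV_bdd H i a t g)
  rw [h1]
  have h2 : ∫ ω, ({fun _ => 0}ᶜ : Set (Fin n → ℕ)).indicator (fun _ => 2 * M) ω ∂π =
      2 * M * (1 - (ν.real {0}) ^ n) := by
    rw [integral_indicator_const _ (MeasurableSet.of_discrete), probReal_compl_eq_one_sub
      (MeasurableSet.of_discrete), h0, smul_eq_mul, mul_comm]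
  rw [← h2, ← Real.norm_eq_abs]
  refine norm_integral_le_of_norm_le ?_ (Eventually.of_forall fun ω => ?_)
  · exact (integrable_const _).indicator (MeasurableSet.of_discrete)
  · by_cases hω : ω = fun _ => 0
    · subst hω
      rw [Set.indicator_of_notMem (by simp)]
      have : mixP d g (fun _ => 0) = g := rfl
      simp [this]
    · rw [Set.indicator_of_mem (by simpa using hω), Real.norm_eq_abs]
      have h3 := pureV_bdd H i a t (mixP d g ω)
      have h4 := pureV_bdd H i a t g
      rw [abs_le] at *
      constructor <;> linarith

/-! ### The finite game with strictly increasing differences -/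

theorem cdf_null {X : Type} [LinearOrder X] [TopologicalSpace X] [OrderTopology X]
    [SecondCountableTopology X] [MeasurableSpace X] [BorelSpace X] (μ : Measure X)
    [IsFiniteMeasure μ] (hμ : ∀ x, μ {x} = 0) (c : ℝ) : μ {t | μ.real (Set.Iic t) = c} = 0 := by
  set K := {t | μ.real (Set.Iic t) = c} with hK
  have hIoc : ∀ x ∈ K, ∀ y ∈ K, x < y → μ (Set.Ioc x y) = 0 := by
    intro x hx y hy hxy
    have h1 : Set.Ioc x y = Set.Iic y \ Set.Iic x := by
      ext z; simp [and_comm]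
    have h2 : μ.real (Set.Ioc x y) = 0 := by
      rw [h1, measureReal_diff (Set.Iic_subset_Iic.2 hxy.le) measurableSet_Iic]
      rw [hx, hy, sub_self]
    exact (measureReal_eq_zero_iff).1 h2
  refine measure_null_of_locally_null K fun x hx => ?_
  have hR : ∃ V ∈ nhds x, μ (K ∩ V ∩ Set.Ioi x) = 0 := by
    by_cases h : ∃ y ∈ K, x < y
    · obtain ⟨y, hy, hxy⟩ := h
      refine ⟨Set.Iio y, Iio_mem_nhds hxy, measure_mono_null ?_ (hIoc x hx y hy hxy)⟩
      rintro z ⟨⟨-, hz⟩, hz'⟩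
      exact ⟨hz', le_of_lt hz⟩
    · refine ⟨Set.univ, univ_mem, ?_⟩
      convert measure_empty (μ := μ)
      ext z
      simp only [Set.inter_univ, Set.mem_inter_iff, Set.mem_Ioi, Set.mem_empty_iff_false, iff_false]
      rintro ⟨h1, h2⟩; exact h ⟨z, h1, h2⟩
  have hL : ∃ V ∈ nhds x, μ (K ∩ V ∩ Set.Iio x) = 0 := by
    by_cases h : ∃ y ∈ K, y < x
    · obtain ⟨y, hy, hxy⟩ := h
      refine ⟨Set.Ioi y, Ioi_mem_nhds hxy, measure_mono_null ?_ (hIoc y hy x hx hxy)⟩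
      rintro z ⟨⟨-, hz⟩, hz'⟩
      exact ⟨hz, le_of_lt hz'⟩
    · refine ⟨Set.univ, univ_mem, ?_⟩
      convert measure_empty (μ := μ)
      ext z
      simp only [Set.inter_univ, Set.mem_inter_iff, Set.mem_Iio, Set.mem_empty_iff_false, iff_false]
      rintro ⟨h1, h2⟩; exact h ⟨z, h1, h2⟩
  obtain ⟨V, hV, hV0⟩ := hR
  obtain ⟨V', hV', hV0'⟩ := hL
  refine ⟨K ∩ (V ∩ V'), ?_, ?_⟩
  · exact inter_mem self_mem_nhdsWithin (mem_nhdsWithin_of_mem_nhds (inter_mem hV hV'))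
  · refine measure_mono_null (t := (K ∩ V ∩ Set.Ioi x) ∪ (K ∩ V' ∩ Set.Iio x) ∪ {x}) ?_ ?_
    · rintro z ⟨hz, hzV, hzV'⟩
      rcases lt_trichotomy z x with h | h | h
      · exact Or.inl (Or.inr ⟨⟨hz, hzV'⟩, h⟩)
      · exact Or.inr h
      · exact Or.inl (Or.inl ⟨⟨hz, hzV⟩, h⟩)
    · rw [measure_union_null_iff, measure_union_null_iff]
      exact ⟨⟨hV0, hV0'⟩, hμ x⟩

/-- The action selected by thresholds `q` at level `x`. -/
def stepA {α : Type} [LinearOrder α] (D : Finset α) (hD : D.Nonempty) (q : α → ℝ) (x : ℝ) : α :=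
  (insert (D.min' hD) (D.filter fun a => q a < x)).max' (Finset.insert_nonempty _ _)

theorem stepA_mono {α : Type} [LinearOrder α] (D : Finset α) (hD : D.Nonempty) (q : α → ℝ) :
    Monotone (stepA D hD q) := by
  intro x y hxy
  refine Finset.max'_subset _ ?_
  refine Finset.insert_subset_insert _ ?_
  intro a ha
  rw [Finset.mem_filter] at ha ⊢
  exact ⟨ha.1, lt_of_lt_of_le ha.2 hxy⟩

theorem stepA_eventually {α : Type} [LinearOrder α] (D : Finset α) (hD : D.Nonempty)
    (q : ℕ → α → ℝ) (q' : α → ℝ) (x : ℝ)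
    (hq : ∀ a ∈ D, Tendsto (fun m => q m a) atTop (nhds (q' a))) (hx : ∀ a ∈ D, x ≠ q' a) :
    ∀ᶠ m in atTop, stepA D hD (q m) x = stepA D hD q' x := by
  have : ∀ᶠ m in atTop, ∀ a ∈ D, (q m a < x ↔ q' a < x) := by
    rw [Filter.eventually_all_finset]
    intro a ha
    rcases lt_or_gt_of_ne (hx a ha) with h | h
    · filter_upwards [(hq a ha).eventually (lt_mem_nhds h)] with m hm
      exact ⟨fun h' => absurd h' (not_lt.2 hm.le), fun h' => absurd h' (not_lt.2 h.le)⟩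
    · filter_upwards [(hq a ha).eventually (gt_mem_nhds h)] with m hm
      exact ⟨fun _ => h, fun _ => hm⟩
  filter_upwards [this] with m hm
  simp only [stepA]
  congr 2
  exact Finset.filter_congr hm

theorem stepA_eq {α : Type} [LinearOrder α] (D : Finset α) (hD : D.Nonempty) (q : α → ℝ) (x : ℝ)
    (b : α) (hb : b ∈ D) (h : ∀ a ∈ D, q a < x ↔ a ≤ b) : stepA D hD q x = b := by
  refine le_antisymm ?_ ?_
  · refine Finset.max'_le _ _ _ fun a ha => ?_
    rcases Finset.mem_insert.1 ha with rfl | ha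
    · exact Finset.min'_le _ _ hb
    · rw [Finset.mem_filter] at ha
      exact (h a ha.1).1 ha.2
  · refine Finset.le_max' _ _ (Finset.mem_insert_of_mem ?_)
    rw [Finset.mem_filter]
    exact ⟨hb, (h b hb).2 le_rfl⟩

theorem finite_equilibrium (H : GameHyp u cond prior M) (d : ∀ j, ℕ → ↥(S j)) (ν : Measure ℕ)
    [IsProbabilityMeasure ν] (D : ∀ i, Finset ↥(S i)) (hD : ∀ i, (D i).Nonempty)
    (θ : ∀ i, T i → ℝ) (hθ : ∀ i, StrictMono (θ i)) (ε : ℝ) (hε : 0 < ε) :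
    ∃ g : ∀ i, T i → ↥(S i), (∀ i, Monotone (g i)) ∧
      ∀ i, ∀ᵐ t ∂(prior.map fun τ => τ i), ∀ a ∈ D i,
        mixV u cond d ν i a t g + ε * (a : ℝ) * θ i t ≤
          mixV u cond d ν i (g i t) t g + ε * (g i t : ℝ) * θ i t := by
  classical
  have := H.prob
  set lam : ∀ i, Measure (T i) := fun i => prior.map fun τ => τ i with hlam
  have hprob : ∀ i, IsProbabilityMeasure (lam i) := fun i =>
    Measure.isProbabilityMeasure_map (measurable_pi_apply i).aemeasurable
  let Q : ∀ i, T i → ℝ := fun i t => (lam i).real (Set.Iic t)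
  have hQm : ∀ i, Monotone (Q i) := fun i s t hst =>
    measureReal_mono (Set.Iic_subset_Iic.2 hst)
  let ext : ((Σ i, ↥(D i)) → ℝ) → ∀ i, ↥(S i) → ℝ := fun q i a =>
    if h : a ∈ D i then q ⟨i, ⟨a, h⟩⟩ else 0
  let st : ((Σ i, ↥(D i)) → ℝ) → ∀ i, T i → ↥(S i) := fun q i t =>
    stepA (D i) (hD i) (ext q i) (Q i t)
  have hst : ∀ q i, Monotone (st q i) := fun q i => (stepA_mono _ _ _).comp (hQm i)
  let U : ((Σ i, ↥(D i)) → ℝ) → ∀ i, ↥(S i) → T i → ℝ := fun q i a t =>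
    mixV u cond d ν i a t (st q) + ε * (a : ℝ) * θ i t
  have hUincr : ∀ q i (a a' : ↥(S i)) (t t' : T i), a < a' → t < t' →
      U q i a' t - U q i a t < U q i a' t' - U q i a t' := by
    intro q i a a' t t' ha ht
    have h1 := mixV_incr H d ν i (hst q) ha ht
    simp only at h1
    have h2 : 0 < ε * ((a' : ℝ) - a) * (θ i t' - θ i t) := by
      have h3 : (0 : ℝ) < (a' : ℝ) - a := sub_pos.2 ha
      have h4 : 0 < θ i t' - θ i t := sub_pos.2 (hθ i ht)
      positivity
    simp only [U]
    nlinarith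
  have hbr : ∀ q i t, ∃ a ∈ D i, ∀ a' ∈ D i, U q i a' t ≤ U q i a t := fun q i t =>
    Finset.exists_max_image (D i) (fun a => U q i a t) (hD i)
  choose b hbD hbmax using hbr
  have hbm : ∀ q i, Monotone (b q i) := by
    intro q i
    rw [monotone_iff_forall_lt]
    intro t t' htt
    by_contra hcon
    push Not at hcon
    have h1 := hUincr q i _ _ t t' hcon htt
    have h2 := hbmax q i t _ (hbD q i t')
    have h3 := hbmax q i t' _ (hbD q i t)
    linarith
  have hbmeas : ∀ q i (a : ↥(S i)), MeasurableSet {t | b q i t < a} := fun q i a => by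
    have h1 := mono_measurable (hbm q i)
    have : {t | b q i t < a} = (b q i) ⁻¹' {x | (x : ℝ) < a} := rfl
    rw [this]
    exact h1 (measurableSet_lt measurable_subtype_coe measurable_const)
  let F : ((Σ i, ↥(D i)) → ℝ) → ((Σ i, ↥(D i)) → ℝ) := fun q p =>
    (lam p.1).real {t | b q p.1 t < p.2.1}
  have hF : Continuous F := by
    rw [continuous_iff_seqContinuous]
    intro qm q hq
    rw [tendsto_pi_nhds]
    rintro ⟨i, a₀⟩
    simp only [F, Function.comp, measureReal_def]
    refine (ENNReal.tendsto_toReal (measure_ne_top _ _)).comp ?_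
    refine tendsto_measure_of_ae_tendsto_indicator atTop (hbmeas q i a₀) (fun m => hbmeas _ i a₀)
      MeasurableSet.univ (measure_ne_top _ _) (Eventually.of_forall fun _ => Set.subset_univ _) ?_
    -- null events
    have hn1 : ∀ᵐ t ∂(lam i), ∀ j (a : ↥(D j)), cond i t {s | Q j (s j) = ext q j a} = 0 := by
      rw [ae_all_iff]; intro j
      rw [ae_all_iff]; intro a
      have hms : MeasurableSet {x | Q j x = ext q j a} :=
        (hQm j).measurable (measurableSet_singleton _)
      refine H.condnull i _ (measurable_pi_apply j hms) ?_
      have := cdf_null (lam j) (H.atomless j) (ext q j a)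
      rw [hlam] at this
      rwa [Measure.map_apply (measurable_pi_apply j) hms] at this
    have hn2 : ∀ᵐ t ∂(lam i), ∀ a a' : ↥(D i), a.1 < a'.1 → U q i a t ≠ U q i a' t := by
      rw [ae_all_iff]; intro a
      rw [ae_all_iff]; intro a'
      by_cases haa : a.1 < a'.1
      · have hsub : {t | U q i a t = U q i a' t}.Subsingleton := by
          intro t ht t' ht'
          simp only [Set.mem_setOf_eq] at ht ht'
          by_contra hne
          rcases lt_or_gt_of_ne hne with h | h
          · have := hUincr q i _ _ t t' haa h
            linarith
          · have := hUincr q i _ _ t' t haa h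
            linarith
        have h0 : lam i {t | U q i a t = U q i a' t} = 0 := by
          rcases hsub.eq_empty_or_singleton with h | ⟨x, h⟩
          · rw [h]; exact measure_empty
          · rw [h]; exact H.atomless i x
        have h0' : ∀ᵐ t ∂(lam i), ¬ (U q i a t = U q i a' t) := by
          rw [ae_iff]; simpa using h0
        filter_upwards [h0'] with t ht _
        exact ht
      · exact Eventually.of_forall fun t h => absurd h haa
    filter_upwards [hn1, hn2] with t ht1 ht2
    have hext : ∀ j (a : ↥(S j)), Tendsto (fun m => ext (qm m) j a) atTop (nhds (ext q j a)) := by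
      intro j a
      simp only [ext]
      split_ifs with h
      · exact (tendsto_pi_nhds.1 hq) _
      · exact tendsto_const_nhds
    have hconv : ∀ a : ↥(S i), Tendsto (fun m => U (qm m) i a t) atTop (nhds (U q i a t)) := by
      intro a
      simp only [U]
      refine Tendsto.add ?_ tendsto_const_nhds
      refine mixV_tendsto H d ν i t (fun m j => hst (qm m) j) ?_ tendsto_const_nhds
      have hae : ∀ᵐ s ∂(cond i t), ∀ j (a : ↥(D j)), ¬ (Q j (s j) = ext q j a) := by
        rw [ae_all_iff]; intro j
        rw [ae_all_iff]; intro a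
        rw [ae_iff]
        simpa using ht1 j a
      filter_upwards [hae] with s hs j
      refine tendsto_const_nhds.congr' ?_
      have := stepA_eventually (D j) (hD j) (fun m => ext (qm m) j) (ext q j) (Q j (s j))
        (fun a _ => hext j a) (fun a ha => hs j ⟨a, ha⟩)
      filter_upwards [this] with m hm
      exact hm.symm
    have hstrict : ∀ a ∈ D i, a ≠ b q i t → U q i a t < U q i (b q i t) t := by
      intro a ha hne
      refine lt_of_le_of_ne (hbmax q i t a ha) ?_
      rcases lt_or_gt_of_ne hne with h | h
      · exact ht2 ⟨a, ha⟩ ⟨_, hbD q i t⟩ h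
      · exact (ht2 ⟨_, hbD q i t⟩ ⟨a, ha⟩ h).symm
    have hev : ∀ᶠ m in atTop, ∀ a ∈ D i, a ≠ b q i t →
        U (qm m) i a t < U (qm m) i (b q i t) t := by
      rw [Filter.eventually_all_finset]
      intro a ha
      by_cases hne : a = b q i t
      · exact Eventually.of_forall fun m h => absurd hne h
      · filter_upwards [(hconv a).eventually_lt (hconv (b q i t)) (hstrict a ha hne)] with m hm _
        exact hm
    filter_upwards [hev] with m hm
    have heq : b (qm m) i t = b q i t := by
      by_contra hne
      have h1 := hm _ (hbD (qm m) i t) hne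
      have h2 := hbmax (qm m) i t _ (hbD q i t)
      linarith
    simp only [Set.mem_setOf_eq, heq]
  obtain ⟨q, hq⟩ := Scarf.brouwer_cube F hF (fun q p => measureReal_nonneg)
    (fun q p => measureReal_le_one)
  refine ⟨st q, hst q, fun i => ?_⟩
  have hn : ∀ᵐ t ∂(lam i), ∀ a : ↥(D i), ¬ (Q i t = ext q i a) := by
    rw [ae_all_iff]; intro a
    rw [ae_iff]
    simpa using cdf_null (lam i) (H.atomless i) (ext q i a)
  filter_upwards [hn] with t ht
  have hst_eq : st q i t = b q i t := by
    refine stepA_eq _ _ _ _ _ (hbD q i t) fun a ha => ?_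
    have hqa : ext q i a = (lam i).real {s | b q i s < a} := by
      simp only [ext]
      rw [dif_pos ha]
      exact (congrFun hq ⟨i, ⟨a, ha⟩⟩).symm
    have hne := ht ⟨a, ha⟩
    simp only at hne
    constructor
    · intro hlt
      by_contra hcon
      push Not at hcon
      have : Q i t ≤ ext q i a := by
        rw [hqa]
        refine measureReal_mono ?_
        intro s hs
        exact lt_of_le_of_lt (hbm q i hs) hcon
      exact absurd hlt (not_lt.2 this)
    · intro hle
      refine lt_of_le_of_ne ?_ (fun h => hne h.symm)
      rw [hqa]
      refine measureReal_mono ?_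
      intro s hs
      simp only [Set.mem_setOf_eq] at hs
      by_contra hcon
      simp only [Set.mem_Iic, not_le] at hcon
      exact absurd (lt_of_lt_of_le hs hle) (not_lt.2 (hbm q i hcon.le))
  intro a ha
  rw [hst_eq]
  exact hbmax q i t a ha

theorem perturbed_equilibrium [∀ i, DenselyOrdered (T i)] [∀ i, CompactSpace ↥(S i)]
    (H : GameHyp u cond prior M) (d : ∀ j, ℕ → ↥(S j)) (hd : ∀ j, DenseRange (d j))
    (ν : Measure ℕ) [IsProbabilityMeasure ν]
    (θ : ∀ i, T i → ℝ) (hθ : ∀ i, StrictMono (θ i)) :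
    ∃ g : ∀ i, T i → ↥(S i), (∀ i, Monotone (g i)) ∧
      ∀ i, ∀ᵐ t ∂(prior.map fun τ => τ i), ∀ a,
        mixV u cond d ν i a t g ≤ mixV u cond d ν i (g i t) t g := by
  classical
  have hex := fun m : ℕ => finite_equilibrium H d ν
    (fun i => (Finset.range (m + 1)).image (d i)) (fun i => by simp) θ hθ
    (1 / ((m : ℝ) + 1)) (by positivity)
  choose g hg he using hex
  obtain ⟨φ, hφ, G, hG, hlim⟩ := helly_selection g hg
  refine ⟨G, hG, fun i => ?_⟩
  have hall : ∀ᵐ t ∂(prior.map fun τ => τ i), ∀ m, ∀ a ∈ (Finset.range (m + 1)).image (d i),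
        mixV u cond d ν i a t (g m) + (1 / ((m : ℝ) + 1)) * (a : ℝ) * θ i t ≤
          mixV u cond d ν i (g m i t) t (g m) + (1 / ((m : ℝ) + 1)) * (g m i t : ℝ) * θ i t :=
    ae_all_iff.2 fun m => he m i
  filter_upwards [hall] with t ht
  have hε : Tendsto (fun m => 1 / (((φ m : ℕ) : ℝ) + 1)) atTop (nhds 0) :=
    tendsto_one_div_add_atTop_nhds_zero_nat.comp hφ.tendsto_atTop
  have hlim' : ∀ᵐ s ∂(cond i t), ∀ j,
      Tendsto (fun m => g (φ m) j (s j)) atTop (nhds (G j (s j))) :=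
    Eventually.of_forall fun s j => hlim j (s j)
  have hkey : ∀ r, mixV u cond d ν i (d i r) t G ≤ mixV u cond d ν i (G i t) t G := by
    intro r
    have h1 := mixV_tendsto H d ν i t (fun m => hg (φ m)) hlim'
      (tendsto_const_nhds (x := d i r))
    have h2 := mixV_tendsto H d ν i t (fun m => hg (φ m)) hlim' (hlim i t)
    have h3 : Tendsto (fun m => (1 / (((φ m : ℕ) : ℝ) + 1)) * ((d i r : ↥(S i)) : ℝ) * θ i t)
        atTop (nhds (0 * ((d i r : ↥(S i)) : ℝ) * θ i t)) :=
      (hε.mul_const _).mul_const _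
    have hv : Tendsto (fun m => ((g (φ m) i t : ↥(S i)) : ℝ)) atTop (nhds (G i t : ℝ)) :=
      (continuous_subtype_val.tendsto _).comp (hlim i t)
    have h4 : Tendsto (fun m => (1 / (((φ m : ℕ) : ℝ) + 1)) * (g (φ m) i t : ℝ) * θ i t)
        atTop (nhds (0 * (G i t : ℝ) * θ i t)) :=
      (hε.mul hv).mul_const _
    have h5 := le_of_tendsto_of_tendsto (h1.add h3) (h2.add h4) (by
      filter_upwards [hφ.tendsto_atTop.eventually_ge_atTop r] with m hm
      exact ht (φ m) (d i r) (Finset.mem_image_of_mem _ (Finset.mem_range.2 (by omega))))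
    simpa using h5
  intro a
  have hc : Continuous fun a => mixV u cond d ν i a t G := by
    refine continuous_iff_seqContinuous.2 fun x y hx => ?_
    exact mixV_tendsto H d ν i t (fun _ => hG)
      (Eventually.of_forall fun s j => tendsto_const_nhds) hx
  exact (hd i).induction_on a (isClosed_le hc continuous_const) hkey

theorem hat_mixed (d : ∀ j, ℕ → ↥(S j)) (ν : Measure ℕ) [IsProbabilityMeasure ν]
    {g : ∀ j, T j → ↥(S j)} (hg : ∀ j, Monotone (g j)) (i : Fin n) :
    IsMixedStrategy (hatP d ν g i) := by
  have hm : ∀ t, Measurable (mixA (g i t) (d i)) := fun t => measurable_from_top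
  refine ⟨fun t => Measure.isProbabilityMeasure_map (hm t).aemeasurable, fun B hB => ?_⟩
  classical
  have h : (fun t => hatP d ν g i t B) = fun t =>
      if t ∈ (g i) ⁻¹' B then ν ({0} ∪ {r | ∃ q, r = q + 1 ∧ d i q ∈ B})
      else ν {r | ∃ q, r = q + 1 ∧ d i q ∈ B} := by
    ext t
    simp only [hatP]
    rw [Measure.map_apply (hm t) hB]
    split_ifs with h
    · congr 1
      ext r
      cases r with
      | zero => simpa [mixA] using h
      | succ q => simp [mixA]
    · congr 1
      ext r
      cases r with
      | zero => simpa [mixA] using h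
      | succ q => simp [mixA]
  rw [h]
  exact Measurable.ite (mono_measurable (hg i) hB) measurable_const measurable_const

theorem hat_completely (d : ∀ j, ℕ → ↥(S j)) (hd : ∀ j, DenseRange (d j)) (ν : Measure ℕ)
    (hν : ∀ r, 0 < ν {r}) (g : ∀ j, T j → ↥(S j)) : CompletelyMixed (hatP d ν g) := by
  intro i t O hO hne
  obtain ⟨r, hr⟩ := (hd i).exists_mem_open hO hne
  have hm : Measurable (mixA (g i t) (d i)) := measurable_from_top
  simp only [hatP]
  rw [Measure.map_apply hm hO.measurableSet]
  refine lt_of_lt_of_le (hν (r + 1)) (measure_mono ?_)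
  intro q hq
  rw [Set.mem_singleton_iff] at hq
  subst hq
  exact hr

theorem prohorov_nonneg {Ω : Type} [MeasurableSpace Ω] [PseudoMetricSpace Ω]
    (μ ν : Measure Ω) [IsProbabilityMeasure μ] : 0 ≤ prohorovDist μ ν ∧
    BddBelow {ε : ℝ | ∀ B : Set Ω, MeasurableSet B →
      μ B ≤ ν (Metric.thickening ε B) + ENNReal.ofReal ε ∧
      ν B ≤ μ (Metric.thickening ε B) + ENNReal.ofReal ε} := by
  have h : ∀ ε ∈ {ε : ℝ | ∀ B : Set Ω, MeasurableSet B →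
      μ B ≤ ν (Metric.thickening ε B) + ENNReal.ofReal ε ∧
      ν B ≤ μ (Metric.thickening ε B) + ENNReal.ofReal ε}, 0 ≤ ε := by
    intro ε hε
    by_contra hneg
    push Not at hneg
    have := (hε Set.univ MeasurableSet.univ).1
    rw [Metric.thickening_of_nonpos hneg.le, ENNReal.ofReal_of_nonpos hneg.le] at this
    simp at this
  exact ⟨Real.sInf_nonneg h, ⟨0, h⟩⟩

theorem prohorov_hat_le {s : Set ℝ} (d : ℕ → ↥s) (ν : Measure ℕ) [IsProbabilityMeasure ν]
    (x y : ↥s) (ε : ℝ) (hxy : dist x y < ε) (hν : 1 - ν.real {0} ≤ ε) :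
    prohorovDist (Measure.map (mixA x d) ν) (Measure.dirac y) ≤ ε := by
  have hm : Measurable (mixA x d) := measurable_from_top
  have hp : IsProbabilityMeasure (Measure.map (mixA x d) ν) :=
    Measure.isProbabilityMeasure_map hm.aemeasurable
  refine csInf_le (prohorov_nonneg _ _).2 ?_
  have h0 : ν {0}ᶜ ≤ ENNReal.ofReal ε := by
    rw [← ofReal_measureReal, probReal_compl_eq_one_sub MeasurableSet.of_discrete]
    exact ENNReal.ofReal_le_ofReal hν
  have h1 : (1 : ENNReal) ≤ ν {0} + ENNReal.ofReal ε := by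
    calc (1 : ENNReal) = ν Set.univ := measure_univ.symm
      _ = ν ({0} ∪ {0}ᶜ) := by rw [Set.union_compl_self]
      _ ≤ ν {0} + ν {0}ᶜ := measure_union_le _ _
      _ ≤ _ := by gcongr
  intro B hB
  rw [Measure.map_apply hm hB, Measure.map_apply hm Metric.isOpen_thickening.measurableSet,
    Measure.dirac_apply' _ hB, Measure.dirac_apply' _ Metric.isOpen_thickening.measurableSet]
  constructor
  · by_cases hx : x ∈ B
    · have : y ∈ Metric.thickening ε B :=
        Metric.mem_thickening_iff.2 ⟨x, hx, by rwa [dist_comm]⟩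
      rw [Set.indicator_of_mem this]
      exact prob_le_one.trans (by simp)
    · refine le_trans (le_trans (measure_mono ?_) h0) le_add_self
      rintro r hr hr0
      rw [Set.mem_singleton_iff] at hr0
      subst hr0
      exact hx hr
  · by_cases hy : y ∈ B
    · have : x ∈ Metric.thickening ε B := Metric.mem_thickening_iff.2 ⟨y, hy, hxy⟩
      rw [Set.indicator_of_mem hy]
      refine h1.trans ?_
      gcongr
      intro r hr0
      rw [Set.mem_singleton_iff] at hr0
      subst hr0
      exact this
    · rw [Set.indicator_of_notMem hy]
      exact zero_le

theorem exists_trembles : ∃ ν : ℕ → Measure ℕ, (∀ k, IsProbabilityMeasure (ν k)) ∧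
    (∀ k r, 0 < ν k {r}) ∧ Tendsto (fun k => (ν k).real {0}) atTop (nhds 1) := by
  have hpos : ∀ k : ℕ, 0 < 1 / ((k : ℝ) + 2) := fun k => by positivity
  have hlt : ∀ k : ℕ, 1 / ((k : ℝ) + 2) < 1 := fun k => by
    rw [div_lt_one (by positivity)]
    linarith [(Nat.cast_nonneg k : (0 : ℝ) ≤ k)]
  let p : ℕ → unitInterval := fun k => ⟨1 - 1 / ((k : ℝ) + 2), by
    constructor <;> linarith [hpos k, hlt k]⟩
  have hp0 : ∀ k, p k ≠ 0 := fun k h => by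
    have h1 : 1 - 1 / ((k : ℝ) + 2) = 0 := congrArg Subtype.val h
    linarith [hlt k]
  have hp1 : ∀ k, p k ≠ 1 := fun k h => by
    have h1 : 1 - 1 / ((k : ℝ) + 2) = 1 := congrArg Subtype.val h
    linarith [hpos k]
  refine ⟨fun k => ProbabilityTheory.geometricMeasure (p k), fun k => inferInstance,
    fun k r => ?_, ?_⟩
  · have h := ProbabilityTheory.geometricMeasure_real_singleton_pos (hp0 k) (hp1 k) r
    exact (measureReal_ne_zero_iff).1 h.ne' |>.bot_lt
  · have h : ∀ k, (ProbabilityTheory.geometricMeasure (p k)).real {0} = 1 - 1 / ((k : ℝ) + 2) := by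
      intro k
      rw [ProbabilityTheory.geometricMeasure_real_singleton (hp0 k)]
      simp [p]
    simp only [h]
    have h2 : Tendsto (fun k : ℕ => 1 / ((k : ℝ) + 2)) atTop (nhds 0) := by
      have := (tendsto_one_div_add_atTop_nhds_zero_nat (𝕜 := ℝ)).comp (tendsto_add_atTop_nat 1)
      refine this.congr fun k => ?_
      simp only [Function.comp, Nat.cast_add, Nat.cast_one]
      ring_nf
    simpa using h2.const_sub 1

theorem exists_perfect [∀ i, DenselyOrdered (T i)] [∀ i, CompactSpace ↥(S i)]
    (H : GameHyp u cond prior M) (d : ∀ j, ℕ → ↥(S j)) (hd : ∀ j, DenseRange (d j))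
    (θ : ∀ i, T i → ℝ) (hθ : ∀ i, StrictMono (θ i)) :
    ∃ g : ∀ i, T i → ↥(S i), (∀ i, Measurable (g i)) ∧ (∀ i, Monotone (g i)) ∧
      IsBNE u cond prior g ∧ IsPerfect u cond prior g := by
  obtain ⟨ν, hνp, hνpos, hν1⟩ := exists_trembles
  have hex := fun k : ℕ => perturbed_equilibrium H d hd (ν k) θ hθ
  choose g hg he using hex
  obtain ⟨φ, hφ, G, hG, hlim⟩ := helly_selection g hg
  have hν2 : Tendsto (fun k => (ν (φ k)).real {0}) atTop (nhds 1) := hν1.comp hφ.tendsto_atTop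
  have hall : ∀ i, ∀ᵐ t ∂(prior.map fun τ => τ i), ∀ k a,
        mixV u cond d (ν k) i a t (g k) ≤ mixV u cond d (ν k) i (g k i t) t (g k) :=
    fun i => ae_all_iff.2 fun k => he k i
  refine ⟨G, fun i => mono_measurable (hG i), hG, fun i => ?_,
    fun k => hatP d (ν (φ k)) (g (φ k)), fun k i => hat_mixed d _ (hg _) i,
    fun k => hat_completely d hd _ (hνpos _) _, fun i => ?_⟩
  · filter_upwards [hall i] with t ht a
    rw [interim_dirac, interim_dirac]
    have hlim' : ∀ᵐ s ∂(cond i t), ∀ j,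
        Tendsto (fun m => g (φ m) j (s j)) atTop (nhds (G j (s j))) :=
      Eventually.of_forall fun s j => hlim j (s j)
    have h1 := pureV_tendsto H i t (fun m => hg (φ m)) hlim' (tendsto_const_nhds (x := a))
    have h2 := pureV_tendsto H i t (fun m => hg (φ m)) hlim' (hlim i t)
    have h3 : Tendsto (fun k => 2 * (2 * M * (1 - ((ν (φ k)).real {0}) ^ n))) atTop (nhds 0) := by
      have := (((hν2.pow n).const_sub 1).const_mul (2 * M)).const_mul 2
      simpa using this
    have h4 := le_of_tendsto_of_tendsto' h1 (h2.add h3) (fun k => by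
      have e1 := abs_le.1 (mixV_sub_le H d (ν (φ k)) i a t (g (φ k)))
      have e2 := abs_le.1 (mixV_sub_le H d (ν (φ k)) i (g (φ k) i t) t (g (φ k)))
      have e3 := ht (φ k) a
      linarith [e1.1, e1.2, e2.1, e2.2])
    simpa using h4
  · filter_upwards [hall i] with t ht
    have hdist : Tendsto (fun k => dist (g (φ k) i t) (G i t)) atTop (nhds 0) :=
      tendsto_iff_dist_tendsto_zero.1 (hlim i t)
    constructor
    · rw [Metric.tendsto_atTop]
      intro ε hε
      have e1 := hdist.eventually (gt_mem_nhds (half_pos hε))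
      have e2 := hν2.eventually (lt_mem_nhds (show 1 - ε / 2 < 1 by linarith))
      obtain ⟨N, hN⟩ := eventually_atTop.1 (e1.and e2)
      refine ⟨N, fun k hk => ?_⟩
      have hp : IsProbabilityMeasure (hatP d (ν (φ k)) (g (φ k)) i t) :=
        (hat_mixed d _ (hg _) i).1 t
      have h1 := prohorov_hat_le (d i) (ν (φ k)) (g (φ k) i t) (G i t) (ε / 2) (hN k hk).1
        (by linarith [(hN k hk).2])
      have h0 := (prohorov_nonneg (hatP d (ν (φ k)) (g (φ k)) i t) (Measure.dirac (G i t))).1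
      rw [Real.dist_eq, sub_zero, abs_of_nonneg h0]
      exact lt_of_le_of_lt h1 (by linarith)
    · refine squeeze_zero (fun k => infDist_nonneg) (fun k => ?_) hdist
      rw [dist_comm]
      refine infDist_le_dist_of_mem fun a => ?_
      rw [interim_hat H d _ i _ t (hg _), interim_hat H d _ i _ t (hg _)]
      exact ht (φ k) a

end Game
/-- **Theorem (monotone perfection, one-dimensional setting).**  In the one-dimensional
setting—each action space is a finite subset of `ℝ` or a compact interval, each type space is
a compact interval, and the common prior has a joint density with respect to Lebesgue
measure—Assumption 1 (increasing differences of interim payoffs in own action and type against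
monotone strategies of the opponents) guarantees a perfect monotone equilibrium. -/
theorem exists_perfect_monotone_equilibrium_one_dimensional
    {n : ℕ} (hn : 2 ≤ n)
    -- action spaces: finite subsets of ℝ or compact intervals
    (S : Fin n → Set ℝ) (hSne : ∀ i, (S i).Nonempty)
    (hS : ∀ i, (S i).Finite ∨ ∃ a b : ℝ, a ≤ b ∧ S i = Set.Icc a b)
    -- type spaces: compact intervals
    (tlo thi : Fin n → ℝ) (hT : ∀ i, tlo i ≤ thi i)
    -- the common prior: a probability measure with a joint density `f` with respect to
    -- Lebesgue measure on the product of the type intervals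
    (f : (∀ j, ↥(Set.Icc (tlo j) (thi j))) → ℝ)
    (hfmeas : Measurable f) (hfnonneg : ∀ t, 0 ≤ f t)
    (prior : Measure (∀ j, ↥(Set.Icc (tlo j) (thi j))))
    (hprior : prior =
      (Measure.pi fun j => ((volume : Measure ℝ).comap Subtype.val :
        Measure ↥(Set.Icc (tlo j) (thi j)))).withDensity fun t => ENNReal.ofReal (f t))
    [IsProbabilityMeasure prior]
    -- payoffs: bounded, jointly measurable, continuous in actions
    (u : ∀ _ : Fin n, (∀ j, ↥(S j)) → (∀ j, ↥(Set.Icc (tlo j) (thi j))) → ℝ)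
    (hubdd : ∃ M : ℝ, ∀ i a t, |u i a t| ≤ M)
    (humeas : ∀ i, Measurable fun p : (∀ j, ↥(S j)) × (∀ j, ↥(Set.Icc (tlo j) (thi j))) =>
      u i p.1 p.2)
    (hucont : ∀ i t, Continuous fun a => u i a t)
    -- a version of the conditional distribution of the type profile given one's own type
    (cond : ∀ i, ↥(Set.Icc (tlo i) (thi i)) → Measure (∀ j, ↥(Set.Icc (tlo j) (thi j))))
    (hcondprob : ∀ i t, IsProbabilityMeasure (cond i t))
    (hcondmeas : ∀ i (s : Set (∀ j, ↥(Set.Icc (tlo j) (thi j)))), MeasurableSet s →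
      Measurable fun t => cond i t s)
    (hconddis : ∀ i (s : Set (∀ j, ↥(Set.Icc (tlo j) (thi j)))), MeasurableSet s →
      ∫⁻ τ, cond i (τ i) s ∂prior = prior s)
    -- Assumption 1: increasing differences of interim payoffs against monotone strategies
    (assum1 : ∀ i (g : ∀ j, ↥(Set.Icc (tlo j) (thi j)) → ↥(S j)),
      (∀ j, Measurable (g j)) → (∀ j, Monotone (g j)) →
      IncreasingDifferences fun (a : ↥(S i)) (t : ↥(Set.Icc (tlo i) (thi i))) =>
        interim u cond i a t (diracProfile g)) :
    ∃ g : ∀ i, ↥(Set.Icc (tlo i) (thi i)) → ↥(S i),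
      (∀ i, Measurable (g i)) ∧ (∀ i, Monotone (g i)) ∧
      IsBNE u cond prior g ∧ IsPerfect u cond prior g := by
  have hne : ∀ i, Nonempty ↥(S i) := fun i => (hSne i).to_subtype
  have hcomp : ∀ i, CompactSpace ↥(S i) := by
    intro i
    rw [← isCompact_iff_compactSpace]
    rcases hS i with h | ⟨a, b, _, h⟩
    · exact h.isCompact
    · rw [h]; exact isCompact_Icc
  obtain ⟨M, hM⟩ := hubdd
  have hmeq : ∀ i, Measurable fun τ : (∀ j, ↥(Set.Icc (tlo j) (thi j))) => τ i :=
    fun i => measurable_pi_apply i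
  have H : GameHyp u cond prior M := by
    refine ⟨inferInstance, hM, humeas, hucont, hcondprob, ?_, ?_, ?_⟩
    · intro i s hs h0
      have h1 : ∫⁻ t, cond i t s ∂(prior.map fun τ => τ i) = 0 := by
        rw [lintegral_map (hcondmeas i s hs) (hmeq i), hconddis i s hs, h0]
      exact (lintegral_eq_zero_iff (hcondmeas i s hs)).1 h1
    · intro i x
      rw [Measure.map_apply (hmeq i) (measurableSet_singleton x), hprior]
      refine withDensity_absolutelyContinuous _ _ ?_
      have hme : ∀ j, MeasurableEmbedding
          (Subtype.val : ↥(Set.Icc (tlo j) (thi j)) → ℝ) :=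
        fun j => MeasurableEmbedding.subtype_coe measurableSet_Icc
      have hsf : ∀ j, SigmaFinite ((volume : Measure ℝ).comap Subtype.val :
          Measure ↥(Set.Icc (tlo j) (thi j))) := by
        intro j
        have : IsFiniteMeasure ((volume : Measure ℝ).comap Subtype.val :
            Measure ↥(Set.Icc (tlo j) (thi j))) := by
          refine ⟨?_⟩
          rw [(hme j).comap_apply, Subtype.coe_image_univ]
          exact measure_Icc_lt_top
        infer_instance
      have hx : ((volume : Measure ℝ).comap Subtype.val :
          Measure ↥(Set.Icc (tlo i) (thi i))) {x} = 0 := by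
        rw [(hme i).comap_apply]
        simp
      exact Measure.pi_eval_preimage_null _ hx
    · intro i g hg
      have h := assum1 i g (fun j => mono_measurable (hg j)) hg
      simpa only [interim_dirac] using h
  exact exists_perfect H (fun j => TopologicalSpace.denseSeq ↥(S j))
    (fun j => TopologicalSpace.denseRange_denseSeq _) (fun i t => (t : ℝ))
    (fun i s t hst => hst)

end

end MonotonePerfection
end

section
/- Any perfect monotone equilibrium of a Bayesian game (with possibly infinite action spaces) is limit admissible; that is, for each player i, the equilibrium action g_i(t_i) is limit undominated at t_i for λ_i-almost all types t_i. -/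
/-!
Statement 7 (Lemma `lem-admissibility` (2), general case): Any perfect monotone equilibrium
of a Bayesian game is limit admissible: almost every equilibrium action is a limit of
undominated actions.
-/

open MeasureTheory Filter Metric

namespace MonotonePerfection

noncomputable section

variable {n : ℕ} {A : Fin n → Type*} {T : Fin n → Type*}

/-- An action `a` of player `i` is weakly dominated at type `t` if some Borel probability
measure over own actions does at least as well against every mixed strategy profile of the
opponents, and strictly better against some profile. -/
def WeaklyDominated {n : ℕ} {A : Fin n → Type*} {T : Fin n → Type*}
    [∀ i, MeasurableSpace (A i)] [∀ i, MeasurableSpace (T i)]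
    (u : ∀ _ : Fin n, (∀ j, A j) → (∀ j, T j) → ℝ)
    (cond : ∀ i, T i → Measure (∀ j, T j))
    (i : Fin n) (a : A i) (t : T i) : Prop :=
  ∃ σ : Measure (A i), IsProbabilityMeasure σ ∧
    (∀ g : ∀ j, T j → Measure (A j), (∀ j, IsMixedStrategy (g j)) →
      interim u cond i a t g ≤ ∫ a', interim u cond i a' t g ∂σ) ∧
    (∃ g : ∀ j, T j → Measure (A j), (∀ j, IsMixedStrategy (g j)) ∧
      interim u cond i a t g < ∫ a', interim u cond i a' t g ∂σ)

section Helpers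

open ProbabilityTheory

lemma integrable_of_bdd {Ω : Type*} [MeasurableSpace Ω] {μ : Measure Ω} [IsFiniteMeasure μ]
    {f : Ω → ℝ} (hf : Measurable f) {M : ℝ} (hM : ∀ x, |f x| ≤ M) : Integrable f μ :=
  Integrable.of_bound hf.aestronglyMeasurable M (Eventually.of_forall hM)

lemma abs_integral_le_of_bdd {Ω : Type*} [MeasurableSpace Ω] {μ : Measure Ω}
    [IsProbabilityMeasure μ]
    {f : Ω → ℝ} {M : ℝ} (hM : ∀ x, |f x| ≤ M) : |∫ x, f x ∂μ| ≤ M := by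
  have := norm_integral_le_of_norm_le_const (μ := μ) (f := f) (C := M) (Eventually.of_forall hM)
  simpa using this


section Key

variable {X Y S : Type*} [MeasurableSpace Y] [MeasurableSpace S] [MeasurableSpace X]

lemma measurable_kint {π : S → Y} (hπ : Measurable π) {φ : S × X → ℝ} (hφ : Measurable φ)
    (h : Kernel Y X) [IsMarkovKernel h] :
    Measurable (fun s => ∫ b, φ (s, b) ∂(h (π s))) := by
  have := (hφ.stronglyMeasurable).integral_kernel_prod_right' (κ := h.comap π hπ)
  simpa using this.measurable

/-- kernels dominated by `g` -/
lemma key_dominated (μ : Measure S) [IsProbabilityMeasure μ] {π : S → Y} (hπ : Measurable π)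
    {φ : S × X → ℝ} (hφ : Measurable φ) {M : ℝ} (hM : ∀ p, |φ p| ≤ M)
    (g : Kernel Y X) [IsMarkovKernel g]
    (hnonneg : ∀ h : Kernel Y X, IsMarkovKernel h → 0 ≤ ∫ s, ∫ b, φ (s, b) ∂(h (π s)) ∂μ)
    (hg0 : ∫ s, ∫ b, φ (s, b) ∂(g (π s)) ∂μ = 0)
    (h : Kernel Y X) [IsMarkovKernel h] (C : ℕ)
    (hC : ∀ y B, MeasurableSet B → h y B ≤ (C + 1 : ENNReal) * g y B) :
    ∫ s, ∫ b, φ (s, b) ∂(h (π s)) ∂μ = 0 := by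
  set e : ENNReal := (C + 1 : ENNReal)⁻¹ with he
  have hC0 : (C + 1 : ENNReal) ≠ 0 := by simp
  have hCt : (C + 1 : ENNReal) ≠ ⊤ := by finiteness
  have he0 : e ≠ 0 := by simp [he, hCt]
  have het : e ≠ ⊤ := by simp [he]
  have hle : ∀ y, e • h y ≤ g y := by
    intro y
    refine Measure.le_iff.2 fun B hB => ?_
    rw [Measure.smul_apply, smul_eq_mul]
    calc e * h y B ≤ e * ((C + 1 : ENNReal) * g y B) := by gcongr; exact hC y B hB
      _ = g y B := by rw [← mul_assoc, he, ENNReal.inv_mul_cancel hC0 hCt, one_mul]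
  have hfin : ∀ y, IsFiniteMeasure (e • h y) := fun y =>
    ⟨by rw [Measure.smul_apply, smul_eq_mul]; simp [het.lt_top]⟩
  have hsum : ∀ y, ((g y - e • h y) + e • g y) + e • h y = g y + e • g y := by
    intro y
    have := hfin y
    rw [add_right_comm, Measure.sub_add_cancel_of_le (hle y)]
  let k : Kernel Y X :=
    { toFun := fun y => (g y - e • h y) + e • g y
      measurable' := by
        refine Measure.measurable_of_measurable_coe _ fun B hB => ?_
        have : ∀ y, ((g y - e • h y) + e • g y) B = (g y B - e * h y B) + e * g y B := by
          intro y
          have := hfin y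
          rw [Measure.add_apply, Measure.sub_apply hB (hle y)]
          simp
        simp_rw [this]
        have h1 := g.measurable_coe hB
        have h2 := h.measurable_coe hB
        exact (h1.sub (h2.const_mul e)).add (h1.const_mul e) }
  have hk : ∀ y, k y + e • h y = g y + e • g y := hsum
  have hkM : IsMarkovKernel k := by
    refine ⟨fun y => ⟨?_⟩⟩
    have := congrArg (fun m : Measure X => m Set.univ) (hk y)
    simp only [Measure.add_apply, Measure.smul_apply, measure_univ, smul_eq_mul, mul_one] at this
    exact (ENNReal.add_left_inj het).1 this
  have hkint : ∀ s, ∫ b, φ (s, b) ∂(k (π s)) =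
      ∫ b, φ (s, b) ∂(g (π s)) + e.toReal * ∫ b, φ (s, b) ∂(g (π s))
        - e.toReal * ∫ b, φ (s, b) ∂(h (π s)) := by
    intro s
    have hm : Measurable fun b => φ (s, b) := hφ.comp (by fun_prop)
    have hb : ∀ b, |φ (s, b)| ≤ M := fun b => hM _
    have i1 : Integrable (fun b => φ (s, b)) (g (π s)) := integrable_of_bdd hm hb
    have i2 : Integrable (fun b => φ (s, b)) (h (π s)) := integrable_of_bdd hm hb
    have i3 : Integrable (fun b => φ (s, b)) (k (π s)) := integrable_of_bdd hm hb
    have := congrArg (fun m : Measure X => ∫ b, φ (s, b) ∂m) (hk (π s))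
    rw [integral_add_measure i3 (i2.smul_measure het),
      integral_add_measure i1 (i1.smul_measure het), integral_smul_measure,
      integral_smul_measure, smul_eq_mul, smul_eq_mul] at this
    linarith
  have I : ∀ h : Kernel Y X, IsMarkovKernel h →
      Integrable (fun s => ∫ b, φ (s, b) ∂(h (π s))) μ := fun h _ =>
    integrable_of_bdd (measurable_kint hπ hφ h) fun s => abs_integral_le_of_bdd fun b => hM _
  have hk0 := hnonneg k hkM
  simp_rw [hkint] at hk0
  rw [integral_sub (Integrable.fun_add (I g inferInstance) ((I g inferInstance).const_mul _))
    ((I h inferInstance).const_mul _), integral_add (I g inferInstance)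
    ((I g inferInstance).const_mul _), integral_const_mul, integral_const_mul, hg0] at hk0
  have hpos : 0 < e.toReal := ENNReal.toReal_pos he0 het
  have := hnonneg h inferInstance
  nlinarith

variable [MetricSpace X] [CompactSpace X] [BorelSpace X]

/-- localised kernel -/
def locKernel (g : Kernel Y X) [IsMarkovKernel g] (r : ℝ) (N : ℕ) : Kernel (Y × X) X where
  toFun p := if ((N + 1 : ENNReal))⁻¹ < g p.1 (ball p.2 r) then
      (g p.1 (ball p.2 r))⁻¹ • (g p.1).restrict (ball p.2 r) else g p.1
  measurable' := by
    have hm : ∀ B : Set X, MeasurableSet B →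
        Measurable fun p : Y × X => g p.1 (B ∩ ball p.2 r) := by
      intro B hB
      have hs : MeasurableSet {q : (Y × X) × X | q.2 ∈ B ∧ dist q.2 q.1.2 < r} := by
        refine (measurable_snd hB).inter ?_
        exact measurableSet_lt (f := fun q : (Y × X) × X => dist q.2 q.1.2)
          (measurable_snd.dist (measurable_snd.comp measurable_fst)) measurable_const
      have := Kernel.measurable_kernel_prodMk_left (κ := g.comap Prod.fst measurable_fst) hs
      exact this
    have hm0 : Measurable fun p : Y × X => g p.1 (ball p.2 r) := by
      simpa using hm Set.univ MeasurableSet.univ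
    refine Measurable.ite (measurableSet_lt measurable_const hm0) ?_
      (g.measurable.comp measurable_fst)
    refine Measure.measurable_of_measurable_coe _ fun B hB => ?_
    simp only [Measure.smul_apply, Measure.restrict_apply hB, smul_eq_mul]
    exact hm0.inv.mul (hm B hB)

lemma locKernel_apply (g : Kernel Y X) [IsMarkovKernel g] (r : ℝ) (N : ℕ) (p : Y × X) :
    locKernel g r N p = if ((N + 1 : ENNReal))⁻¹ < g p.1 (ball p.2 r) then
      (g p.1 (ball p.2 r))⁻¹ • (g p.1).restrict (ball p.2 r) else g p.1 := rfl

instance (g : Kernel Y X) [IsMarkovKernel g] (r : ℝ) (N : ℕ) :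
    IsMarkovKernel (locKernel g r N) := by
  refine ⟨fun p => ⟨?_⟩⟩
  rw [locKernel_apply]
  split_ifs with hp
  · simp only [Measure.smul_apply, Measure.restrict_apply MeasurableSet.univ, Set.univ_inter,
      smul_eq_mul]
    exact ENNReal.inv_mul_cancel (pos_of_gt hp).ne' (measure_ne_top _ _)
  · exact measure_univ

lemma locKernel_le (g : Kernel Y X) [IsMarkovKernel g] (r : ℝ) (N : ℕ) (p : Y × X)
    (B : Set X) (hB : MeasurableSet B) :
    locKernel g r N p B ≤ (N + 1 : ENNReal) * g p.1 B := by
  rw [locKernel_apply]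
  split_ifs with hp
  · rw [Measure.smul_apply, smul_eq_mul, Measure.restrict_apply hB]
    gcongr
    · exact (ENNReal.inv_le_iff_inv_le.1 hp.le)
    · exact Set.inter_subset_left
  · exact le_mul_of_one_le_left (zero_le) (by simp)

lemma key (μ : Measure S) [IsProbabilityMeasure μ] {π : S → Y} (hπ : Measurable π)
    {φ : S × X → ℝ} (hφ : Measurable φ) {M : ℝ} (hM : ∀ p, |φ p| ≤ M)
    (hcont : ∀ s, Continuous fun x => φ (s, x))
    (g : Kernel Y X) [IsMarkovKernel g]
    (hsupp : ∀ y O, IsOpen O → O.Nonempty → 0 < g y O)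
    (hnonneg : ∀ h : Kernel Y X, IsMarkovKernel h → 0 ≤ ∫ s, ∫ b, φ (s, b) ∂(h (π s)) ∂μ)
    (hg0 : ∫ s, ∫ b, φ (s, b) ∂(g (π s)) ∂μ = 0)
    (h : Kernel Y X) [IsMarkovKernel h] :
    ∫ s, ∫ b, φ (s, b) ∂(h (π s)) ∂μ = 0 := by
  -- joint measure on `S × X`
  let Q : Measure (S × X) := μ ⊗ₘ (h.comap π hπ)
  have hQint : ∀ ψ : S × X → ℝ, Measurable ψ → (∀ p, |ψ p| ≤ M) →
      ∫ p, ψ p ∂Q = ∫ s, ∫ x, ψ (s, x) ∂(h (π s)) ∂μ := by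
    intro ψ h1 h2
    rw [Measure.integral_compProd (integrable_of_bdd h1 h2)]
    rfl
  let Ψ : ℝ → ℕ → S × X → ℝ := fun r N p => ∫ b, φ (p.1, b) ∂(locKernel g r N (π p.1, p.2))
  have hΨm : ∀ r N, Measurable (Ψ r N) := by
    intro r N
    exact measurable_kint (S := S × X) (Y := Y × X) (π := fun p => (π p.1, p.2)) (by fun_prop)
      (φ := fun q => φ (q.1.1, q.2)) (hφ.comp (by fun_prop)) (locKernel g r N)
  have hΨb : ∀ r N p, |Ψ r N p| ≤ M := fun r N p => abs_integral_le_of_bdd fun b => hM _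
  have step1 : ∀ r N, ∫ p, Ψ r N p ∂Q = 0 := by
    intro r N
    rw [hQint _ (hΨm r N) (hΨb r N)]
    have := key_dominated μ hπ hφ hM g hnonneg hg0 (Kernel.snd (h ⊗ₖ locKernel g r N)) N (by
      intro y B hB
      rw [Kernel.snd_apply' _ _ hB, Kernel.compProd_apply (measurable_snd hB)]
      calc _ ≤ ∫⁻ x, (N + 1 : ENNReal) * g y B ∂(h y) :=
            lintegral_mono fun x => locKernel_le g r N (y, x) B hB
        _ = _ := by simp)
    rw [← this]
    congr 1
    ext s
    have hm : Measurable fun b => φ (s, b) := hφ.comp (by fun_prop)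
    rw [Kernel.snd_apply, integral_map measurable_snd.aemeasurable hm.aestronglyMeasurable,
      ProbabilityTheory.integral_compProd]
    exact integrable_of_bdd (hm.comp measurable_snd) fun b => hM _
  let Ψ' : ℝ → S × X → ℝ := fun r p =>
    ∫ b, φ (p.1, b) ∂((g (π p.1) (ball p.2 r))⁻¹ • (g (π p.1)).restrict (ball p.2 r))
  have hlim : ∀ r, 0 < r → ∀ p, ∀ᶠ N in atTop, Ψ r N p = Ψ' r p := by
    intro r hr p
    have hpos := hsupp (π p.1) (ball p.2 r) isOpen_ball ⟨p.2, mem_ball_self hr⟩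
    have ht : Tendsto (fun N : ℕ => ((N + 1 : ENNReal))⁻¹) atTop (nhds 0) := by
      have := (tendsto_add_atTop_iff_nat 1).2 ENNReal.tendsto_inv_nat_nhds_zero
      simpa using this
    filter_upwards [ht.eventually_lt_const hpos] with N hN
    simp only [Ψ, Ψ', locKernel_apply]
    rw [if_pos hN]
  have step2 : ∀ r, 0 < r → ∫ p, Ψ' r p ∂Q = 0 := by
    intro r hr
    have := tendsto_integral_of_dominated_convergence (μ := Q) (F := fun N => Ψ r N) (f := Ψ' r)
      (fun _ => M) (fun N => (hΨm r N).aestronglyMeasurable) (integrable_const M)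
      (fun N => Eventually.of_forall (hΨb r N))
      (Eventually.of_forall fun p =>
        tendsto_const_nhds.congr' ((hlim r hr p).mono fun N h => h.symm))
    simp_rw [step1] at this
    exact tendsto_nhds_unique this tendsto_const_nhds
  have hΨ'm : ∀ r, 0 < r → Measurable (Ψ' r) := fun r hr =>
    measurable_of_tendsto_metrizable (f := fun N => Ψ r N) (fun N => hΨm r N)
      (tendsto_pi_nhds.2 fun p =>
        tendsto_const_nhds.congr' ((hlim r hr p).mono fun N h => h.symm))
  have hΨ'b : ∀ r, 0 < r → ∀ p, |Ψ' r p| ≤ M := by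
    intro r hr p
    obtain ⟨N, hN⟩ := (hlim r hr p).exists
    rw [← hN]; exact hΨb r N p
  let R : ℕ → ℝ := fun m => 1 / ((m : ℝ) + 1)
  have hR : ∀ m, 0 < R m := fun m => by positivity
  have hconv : ∀ p, Tendsto (fun m => Ψ' (R m) p) atTop (nhds (φ p)) := by
    intro p
    rw [Metric.tendsto_atTop]
    intro ε hε
    obtain ⟨δ, hδ, hδ'⟩ := Metric.continuous_iff.1 (hcont p.1) p.2 (ε / 2) (by positivity)
    have : ∀ᶠ m in atTop, R m < δ :=
      tendsto_one_div_add_atTop_nhds_zero_nat.eventually_lt_const hδ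
    obtain ⟨m0, hm0⟩ := eventually_atTop.1 this
    refine ⟨m0, fun m hm => ?_⟩
    have hrδ := hm0 m hm
    set ν : Measure X := (g (π p.1) (ball p.2 (R m)))⁻¹ • (g (π p.1)).restrict (ball p.2 (R m))
      with hν
    have hpos := hsupp (π p.1) (ball p.2 (R m)) isOpen_ball ⟨p.2, mem_ball_self (hR m)⟩
    have hνp : IsProbabilityMeasure ν := ⟨by
      simp only [hν, Measure.smul_apply, Measure.restrict_apply MeasurableSet.univ,
        Set.univ_inter, smul_eq_mul]
      exact ENNReal.inv_mul_cancel hpos.ne' (measure_ne_top _ _)⟩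
    have hmeas : Measurable fun b => φ (p.1, b) := hφ.comp (by fun_prop)
    have hI : Integrable (fun b => φ (p.1, b)) ν := integrable_of_bdd hmeas fun b => hM _
    have hae : ∀ᵐ b ∂ν, ‖φ (p.1, b) - φ p‖ ≤ ε / 2 := by
      refine Measure.ae_smul_measure ?_ _
      filter_upwards [ae_restrict_mem measurableSet_ball] with b hb
      exact (hδ' b (lt_trans (mem_ball.1 hb) hrδ)).le
    have := norm_integral_le_of_norm_le_const hae
    rw [integral_sub hI (integrable_const _)] at this
    simp only [integral_const, probReal_univ, one_smul, mul_one] at this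
    rw [Real.dist_eq]
    exact lt_of_le_of_lt this (by linarith)
  have := tendsto_integral_of_dominated_convergence (μ := Q) (F := fun m => Ψ' (R m)) (f := φ)
      (fun _ => M) (fun m => (hΨ'm _ (hR m)).aestronglyMeasurable) (integrable_const M)
      (fun m => Eventually.of_forall (hΨ'b _ (hR m)))
      (Eventually.of_forall hconv)
  simp_rw [step2 _ (hR _)] at this
  rw [← hQint φ hφ hM]
  exact tendsto_nhds_unique this tendsto_const_nhds

end Key
section Multi

variable {n : ℕ} {A : Fin n → Type*} {T : Fin n → Type*}
variable [∀ i, MeasurableSpace (A i)] [∀ i, MeasurableSpace (T i)]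

lemma IsMixedStrategy.measurable {Y X : Type*} [MeasurableSpace Y] [MeasurableSpace X]
    {g : Y → Measure X} (hg : IsMixedStrategy g) : Measurable g :=
  Measure.measurable_of_measurable_coe _ hg.2

lemma isMixedStrategy_kernel {Y X : Type*} [MeasurableSpace Y] [MeasurableSpace X]
    (h : Kernel Y X) [IsMarkovKernel h] : IsMixedStrategy (fun y => h y) :=
  ⟨fun _ => inferInstance, fun _ hB => h.measurable_coe hB⟩

lemma measurable_pi_profile (g : ∀ j, T j → Measure (A j)) (hg : ∀ j, IsMixedStrategy (g j)) :
    Measurable fun s : ∀ j, T j => Measure.pi fun j => g j (s j) := by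
  have : ∀ j t, IsProbabilityMeasure (g j t) := fun j => (hg j).1
  refine Measurable.measure_of_isPiSystem_of_isProbabilityMeasure
    (S := Set.pi Set.univ '' Set.pi Set.univ fun i => {s : Set (A i) | MeasurableSet s})
    generateFrom_pi.symm isPiSystem_pi ?_
  rintro _ ⟨B, hB, rfl⟩
  simp only [Measure.pi_pi]
  refine Finset.measurable_fun_prod _ fun j _ => ?_
  exact ((hg j).2 (B j) (hB j (Set.mem_univ j))).comp (measurable_pi_apply j)

def piKernel (g : ∀ j, T j → Measure (A j)) (hg : ∀ j, IsMixedStrategy (g j)) :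
    Kernel (∀ j, T j) (∀ j, A j) :=
  ⟨fun s => Measure.pi fun j => g j (s j), measurable_pi_profile g hg⟩

lemma isMarkov_piKernel (g : ∀ j, T j → Measure (A j)) (hg : ∀ j, IsMixedStrategy (g j)) :
    IsMarkovKernel (piKernel g hg) := by
  have : ∀ j t, IsProbabilityMeasure (g j t) := fun j => (hg j).1
  refine ⟨fun s => ?_⟩
  change IsProbabilityMeasure (Measure.pi fun j => g j (s j))
  infer_instance

lemma measurable_upd (j : Fin n) :
    Measurable fun p : A j × (∀ k, A k) => Function.update p.2 j p.1 := by
  rw [measurable_pi_iff]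
  intro k
  by_cases hk : k = j
  · subst hk; simpa using measurable_fst
  · simp only [Function.update_of_ne hk]; fun_prop

lemma pi_update (μ : ∀ j, Measure (A j)) [∀ j, IsProbabilityMeasure (μ j)] (j : Fin n)
    (ν : Measure (A j)) [IsProbabilityMeasure ν] :
    Measure.pi (Function.update μ j ν) =
      (ν.prod (Measure.pi μ)).map (fun p => Function.update p.2 j p.1) := by
  have : ∀ k, IsProbabilityMeasure (Function.update μ j ν k) := by
    intro k
    by_cases hk : k = j
    · subst hk; simpa
    · simp only [Function.update_of_ne hk]; infer_instance
  refine Measure.pi_eq fun B hB => ?_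
  rw [Measure.map_apply (measurable_upd j) (MeasurableSet.univ_pi hB)]
  have hpre : (fun p : A j × (∀ k, A k) => Function.update p.2 j p.1) ⁻¹' (Set.pi Set.univ B) =
      B j ×ˢ Set.pi Set.univ (Function.update B j Set.univ) := by
    ext ⟨x, b⟩
    simp only [Set.mem_preimage, Set.mem_pi, Set.mem_univ, true_implies, Set.mem_prod]
    constructor
    · intro h
      refine ⟨by simpa using h j, fun k => ?_⟩
      by_cases hk : k = j
      · subst hk; simp
      · simpa [Function.update_of_ne hk] using h k
    · rintro ⟨h1, h2⟩ k
      by_cases hk : k = j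
      · subst hk; simpa
      · simpa [Function.update_of_ne hk] using h2 k
  rw [hpre, Measure.prod_prod, Measure.pi_pi, ← Finset.mul_prod_erase _ _ (Finset.mem_univ j),
    ← Finset.mul_prod_erase Finset.univ (fun k => Function.update μ j ν k (B k))
      (Finset.mem_univ j)]
  simp only [Function.update_self, measure_univ, one_mul]
  congr 1
  refine Finset.prod_congr rfl fun k hk => ?_
  rw [Function.update_of_ne (Finset.ne_of_mem_erase hk),
    Function.update_of_ne (Finset.ne_of_mem_erase hk)]

lemma isMixed_update {g : ∀ j, T j → Measure (A j)} (hg : ∀ j, IsMixedStrategy (g j))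
    (j : Fin n) {h : T j → Measure (A j)} (hh : IsMixedStrategy h) :
    ∀ k, IsMixedStrategy (Function.update g j h k) := by
  intro k
  by_cases hk : k = j
  · subst hk; simpa
  · simpa [Function.update_of_ne hk] using hg k

lemma integral_update {g : ∀ j, T j → Measure (A j)} (hg : ∀ j, IsMixedStrategy (g j))
    (j : Fin n) {h : T j → Measure (A j)} (hh : IsMixedStrategy h) (s : ∀ j, T j)
    {f : (∀ j, A j) → ℝ} (hf : Measurable f) {M : ℝ} (hM : ∀ b, |f b| ≤ M) :
    ∫ b, f b ∂(Measure.pi fun k => Function.update g j h k (s k)) =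
      ∫ x, ∫ b, f (Function.update b j x) ∂(Measure.pi fun k => g k (s k)) ∂(h (s j)) := by
  have : ∀ j t, IsProbabilityMeasure (g j t) := fun j => (hg j).1
  have : ∀ t, IsProbabilityMeasure (h t) := hh.1
  have e : (fun k => Function.update g j h k (s k)) =
      Function.update (fun k => g k (s k)) j (h (s j)) := by
    funext k
    by_cases hk : k = j
    · subst hk; simp
    · simp [Function.update_of_ne hk]
  rw [e, pi_update, integral_map (measurable_upd j).aemeasurable hf.aestronglyMeasurable,
    integral_prod (fun p : A j × (∀ k, A k) => f (Function.update p.2 j p.1))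
      (integrable_of_bdd (hf.comp (measurable_upd j)) fun p => hM _)]

variable [∀ i, MetricSpace (A i)] [∀ i, CompactSpace (A i)] [∀ i, BorelSpace (A i)]

lemma one_step (μ : Measure (∀ j, T j)) [IsProbabilityMeasure μ]
    {D : (∀ j, T j) × (∀ j, A j) → ℝ} (hD : Measurable D) {M : ℝ} (hM : ∀ p, |D p| ≤ M)
    (hcont : ∀ s, Continuous fun b => D (s, b))
    (hnonneg : ∀ g : ∀ j, T j → Measure (A j), (∀ j, IsMixedStrategy (g j)) →
      0 ≤ ∫ s, ∫ b, D (s, b) ∂(Measure.pi fun j => g j (s j)) ∂μ)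
    (g : ∀ j, T j → Measure (A j)) (hg : ∀ j, IsMixedStrategy (g j))
    (hg0 : ∫ s, ∫ b, D (s, b) ∂(Measure.pi fun j => g j (s j)) ∂μ = 0)
    (j : Fin n) (hsupp : ∀ (t : T j) (O : Set (A j)), IsOpen O → O.Nonempty → 0 < g j t O)
    (h : T j → Measure (A j)) (hh : IsMixedStrategy h) :
    ∫ s, ∫ b, D (s, b) ∂(Measure.pi fun k => Function.update g j h k (s k)) ∂μ = 0 := by
  have hgp : ∀ j t, IsProbabilityMeasure (g j t) := fun j => (hg j).1
  let φ : (∀ j, T j) × A j → ℝ := fun p =>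
    ∫ b, D (p.1, Function.update b j p.2) ∂(Measure.pi fun k => g k (p.1 k))
  have hmk := isMarkov_piKernel g hg
  have hφm : Measurable φ := by
    refine measurable_kint (S := (∀ j, T j) × A j) (π := Prod.fst) measurable_fst
      (φ := fun q => D (q.1.1, Function.update q.2 j q.1.2)) ?_ (piKernel g hg)
    refine hD.comp (Measurable.prodMk (by fun_prop) ?_)
    exact (measurable_upd j).comp (by fun_prop : Measurable
      fun q : ((∀ j, T j) × A j) × (∀ k, A k) => (q.1.2, q.2))
  have hφb : ∀ p, |φ p| ≤ M := fun p => abs_integral_le_of_bdd fun b => hM _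
  have hφc : ∀ s, Continuous fun x => φ (s, x) := by
    intro s
    refine continuous_of_dominated (μ := Measure.pi fun k => g k (s k)) (F := fun (x : A j) (b : ∀ k, A k) =>
      D (s, Function.update b j x)) (bound := fun _ => M) (fun x => ?_)
      (fun x => Eventually.of_forall fun b => hM _) (integrable_const M)
      (Eventually.of_forall fun b => ?_)
    · refine (hD.comp (Measurable.prodMk measurable_const ?_)).aestronglyMeasurable
      exact (measurable_upd j).comp (by fun_prop : Measurable
        fun b : (∀ k, A k) => (x, b))
    · exact (hcont s).comp (continuous_const.update j continuous_id)
  have hrep : ∀ h : T j → Measure (A j), IsMixedStrategy h →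
      ∫ s, ∫ b, D (s, b) ∂(Measure.pi fun k => Function.update g j h k (s k)) ∂μ =
      ∫ s, ∫ x, φ (s, x) ∂(h (s j)) ∂μ := by
    intro h hh
    congr 1
    funext s
    exact integral_update hg j hh s (f := fun b => D (s, b)) (hD.comp (by fun_prop))
      (fun b => hM _)
  let gK : Kernel (T j) (A j) := ⟨g j, (hg j).measurable⟩
  let hK : Kernel (T j) (A j) := ⟨h, hh.measurable⟩
  have : IsMarkovKernel gK := ⟨(hg j).1⟩
  have : IsMarkovKernel hK := ⟨hh.1⟩
  rw [hrep h hh]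
  refine key μ (π := fun s => s j) (measurable_pi_apply j) hφm hφb hφc gK hsupp ?_ ?_ hK
  · intro h' _
    have := hnonneg _ (isMixed_update hg j (isMixedStrategy_kernel h'))
    rwa [hrep _ (isMixedStrategy_kernel h')] at this
  · have := hrep (g j) (hg j)
    rw [Function.update_eq_self, hg0] at this
    exact this.symm

lemma all_steps (μ : Measure (∀ j, T j)) [IsProbabilityMeasure μ]
    {D : (∀ j, T j) × (∀ j, A j) → ℝ} (hD : Measurable D) {M : ℝ} (hM : ∀ p, |D p| ≤ M)
    (hcont : ∀ s, Continuous fun b => D (s, b))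
    (hnonneg : ∀ g : ∀ j, T j → Measure (A j), (∀ j, IsMixedStrategy (g j)) →
      0 ≤ ∫ s, ∫ b, D (s, b) ∂(Measure.pi fun j => g j (s j)) ∂μ)
    (g : ∀ j, T j → Measure (A j)) (hg : ∀ j, IsMixedStrategy (g j))
    (hg0 : ∫ s, ∫ b, D (s, b) ∂(Measure.pi fun j => g j (s j)) ∂μ = 0)
    (hsupp : CompletelyMixed g)
    (h : ∀ j, T j → Measure (A j)) (hh : ∀ j, IsMixedStrategy (h j)) :
    ∫ s, ∫ b, D (s, b) ∂(Measure.pi fun j => h j (s j)) ∂μ = 0 := by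
  classical
  have main : ∀ F : Finset (Fin n),
      ∫ s, ∫ b, D (s, b) ∂(Measure.pi fun j => (F.piecewise h g) j (s j)) ∂μ = 0 := by
    intro F
    induction F using Finset.induction_on with
    | empty => simpa using hg0
    | insert j F hj ih =>
      rw [Finset.piecewise_insert]
      refine one_step μ hD hM hcont hnonneg _ ?_ ih j ?_ (h j) (hh j)
      · intro k
        by_cases hk : k ∈ F
        · simpa [hk] using hh k
        · simpa [hk] using hg k
      · intro t O hO hne
        simpa [hj] using hsupp j t O hO hne
  simpa using main Finset.univ

/-- Best responses against a completely mixed profile are undominated. -/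
lemma undominated_of_BR
    (u : ∀ _ : Fin n, (∀ j, A j) → (∀ j, T j) → ℝ)
    {M : ℝ} (hM : ∀ i a t, |u i a t| ≤ M)
    (humeas : ∀ i, Measurable fun p : (∀ j, A j) × (∀ j, T j) => u i p.1 p.2)
    (hucont : ∀ i t, Continuous fun a => u i a t)
    (cond : ∀ i, T i → Measure (∀ j, T j))
    (hcondprob : ∀ i t, IsProbabilityMeasure (cond i t))
    (g : ∀ j, T j → Measure (A j)) (hg : ∀ j, IsMixedStrategy (g j))
    (hsupp : CompletelyMixed g) (i : Fin n) (t : T i) (a : A i) (ha : a ∈ BR u cond i t g) :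
    ¬ WeaklyDominated u cond i a t := by
  rintro ⟨σ, hσ, hdom, ĝ, hĝ, hstrict⟩
  have := hcondprob i t
  -- payoff as a function of own action, types and actions
  let w : A i → (∀ j, T j) × (∀ j, A j) → ℝ := fun a' p =>
    u i (Function.update p.2 i a') (Function.update p.1 i t)
  have hw : Measurable fun q : A i × ((∀ j, T j) × (∀ j, A j)) => w q.1 q.2 := by
    refine (humeas i).comp (Measurable.prodMk ?_ ?_)
    · exact (measurable_upd i).comp (by fun_prop : Measurable
        fun q : A i × ((∀ j, T j) × (∀ j, A j)) => (q.1, q.2.2))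
    · exact (measurable_upd (A := T) i).comp (by fun_prop : Measurable
        fun q : A i × ((∀ j, T j) × (∀ j, A j)) => (t, q.2.1))
  have hwa : ∀ a', Measurable (w a') := fun a' => hw.comp (measurable_prodMk_left (x := a'))
  have hwb : ∀ a' p, |w a' p| ≤ M := fun a' p => hM _ _ _
  have hwc : ∀ a' s, Continuous fun b => w a' (s, b) := fun a' s =>
    (hucont i (Function.update s i t)).comp
      ((continuous_id (X := ∀ j, A j)).update i (continuous_const (y := a')))
  let W : (∀ j, T j) × (∀ j, A j) → ℝ := fun p => ∫ a', w a' p ∂σ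
  have hW : Measurable W :=
    (StronglyMeasurable.integral_prod_left' (μ := σ) hw.stronglyMeasurable).measurable
  have hWb : ∀ p, |W p| ≤ M := fun p => abs_integral_le_of_bdd fun a' => hwb a' p
  have hWc : ∀ s, Continuous fun b => W (s, b) := by
    intro s
    refine continuous_of_dominated (bound := fun _ => M) (fun b => ?_)
      (fun b => Eventually.of_forall fun a' => hwb _ _) (integrable_const M)
      (Eventually.of_forall fun a' => hwc a' s)
    exact (hw.comp (by fun_prop : Measurable fun a' : A i =>
      ((a', (s, b)) : A i × ((∀ j, T j) × (∀ j, A j))))).aestronglyMeasurable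
  let D : (∀ j, T j) × (∀ j, A j) → ℝ := fun p => W p - w a p
  have hD : Measurable D := hW.sub (hwa a)
  have hDb : ∀ p, |D p| ≤ M + M := fun p =>
    (abs_sub _ _).trans (add_le_add (hWb p) (hwb a p))
  have hDc : ∀ s, Continuous fun b => D (s, b) := fun s => (hWc s).sub (hwc a s)
  have hrep : ∀ g : ∀ j, T j → Measure (A j), (∀ j, IsMixedStrategy (g j)) →
      Integrable (fun a' => interim u cond i a' t g) σ ∧
      ∫ s, ∫ b, D (s, b) ∂(Measure.pi fun j => g j (s j)) ∂(cond i t) =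
        ∫ a', interim u cond i a' t g ∂σ - interim u cond i a t g := by
    intro g hg
    have := isMarkov_piKernel g hg
    let Q := (cond i t) ⊗ₘ (piKernel g hg)
    have hQ : ∀ {f : (∀ j, T j) × (∀ j, A j) → ℝ} {C : ℝ}, Measurable f → (∀ p, |f p| ≤ C) →
        ∫ s, ∫ b, f (s, b) ∂(Measure.pi fun j => g j (s j)) ∂(cond i t) = ∫ p, f p ∂Q := by
      intro f C h1 h2
      rw [Measure.integral_compProd (integrable_of_bdd h1 h2)]
      rfl
    have hV : ∀ a', interim u cond i a' t g = ∫ p, w a' p ∂Q := fun a' =>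
      hQ (hwa a') (hwb a')
    have hI : Integrable (Function.uncurry w) (σ.prod Q) :=
      integrable_of_bdd (M := M) hw fun q => hwb _ _
    refine ⟨?_, ?_⟩
    · simp_rw [hV]
      exact hI.integral_prod_left
    · rw [hQ hD hDb]
      simp_rw [hV]
      rw [integral_integral_swap hI]
      exact integral_sub (integrable_of_bdd hW hWb) (integrable_of_bdd (hwa a) (hwb a))
  have hzero := all_steps (cond i t) hD hDb hDc
    (fun g hg => by rw [(hrep g hg).2]; linarith [hdom g hg]) g hg (by
      rw [(hrep g hg).2]
      have h1 := hdom g hg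
      have h2 : ∫ a', interim u cond i a' t g ∂σ ≤ ∫ a', interim u cond i a t g ∂σ :=
        integral_mono (hrep g hg).1 (integrable_const _) fun a' => ha a'
      simp only [integral_const, probReal_univ, one_smul] at h2
      linarith) hsupp ĝ hĝ
  rw [(hrep ĝ hĝ).2] at hzero
  linarith

lemma BR_nonempty
    (u : ∀ _ : Fin n, (∀ j, A j) → (∀ j, T j) → ℝ)
    {M : ℝ} (hM : ∀ i a t, |u i a t| ≤ M)
    (humeas : ∀ i, Measurable fun p : (∀ j, A j) × (∀ j, T j) => u i p.1 p.2)
    (hucont : ∀ i t, Continuous fun a => u i a t)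
    (cond : ∀ i, T i → Measure (∀ j, T j))
    (hcondprob : ∀ i t, IsProbabilityMeasure (cond i t))
    (g : ∀ j, T j → Measure (A j)) (hg : ∀ j, IsMixedStrategy (g j))
    (i : Fin n) (t : T i) [Nonempty (A i)] : (BR u cond i t g).Nonempty := by
  have := hcondprob i t
  have hgp : ∀ j t, IsProbabilityMeasure (g j t) := fun j => (hg j).1
  have hmk := isMarkov_piKernel g hg
  have hw : ∀ a', Measurable fun p : (∀ j, T j) × (∀ j, A j) =>
      u i (Function.update p.2 i a') (Function.update p.1 i t) := by
    intro a'
    refine (humeas i).comp (Measurable.prodMk ?_ ?_)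
    · exact (measurable_upd i).comp (by fun_prop : Measurable
        fun q : ((∀ j, T j) × (∀ j, A j)) => (a', q.2))
    · exact (measurable_upd (A := T) i).comp (by fun_prop : Measurable
        fun q : ((∀ j, T j) × (∀ j, A j)) => (t, q.1))
  have hc : Continuous fun a => interim u cond i a t g := by
    unfold interim
    refine continuous_of_dominated (bound := fun _ => M) (fun a => ?_)
      (fun a => Eventually.of_forall fun s => abs_integral_le_of_bdd fun b => hM _ _ _)
      (integrable_const M) (Eventually.of_forall fun s => ?_)
    · exact (measurable_kint (π := id) measurable_id (hw a)
        (piKernel g hg)).aestronglyMeasurable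
    · refine continuous_of_dominated (bound := fun _ => M) (fun a => ?_)
        (fun a => Eventually.of_forall fun b => hM _ _ _)
        (integrable_const M) (Eventually.of_forall fun b => ?_)
      · exact ((hw a).comp (by fun_prop : Measurable fun b : (∀ j, A j) =>
          ((s, b) : (∀ j, T j) × (∀ j, A j)))).aestronglyMeasurable
      · exact (hucont i _).comp (continuous_const.update i continuous_id)
  obtain ⟨a, -, ha⟩ := isCompact_univ.exists_isMaxOn Set.univ_nonempty hc.continuousOn
  exact ⟨a, fun a' => ha (Set.mem_univ a')⟩

end Multi

end Helpers

/-- **Lemma.**  Any perfect monotone equilibrium is limit admissible: for each player `i`,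
for almost all types `t`, the action `g i t` is the limit of a sequence of actions each
of which is undominated at `t`. -/
theorem limitAdmissible_of_perfect_monotone_equilibrium
    {n : ℕ} (hn : 2 ≤ n)
    (A : Fin n → Type*) (T : Fin n → Type*)
    [∀ i, MetricSpace (A i)] [∀ i, CompactSpace (A i)] [∀ i, Lattice (A i)]
    [∀ i, MeasurableSpace (A i)] [∀ i, BorelSpace (A i)]
    [∀ i, MeasurableSpace (T i)] [∀ i, PartialOrder (T i)]
    -- the common prior, with atomless marginals
    (prior : Measure (∀ j, T j)) [IsProbabilityMeasure prior]
    (hatomless : ∀ i, NoAtoms (prior.map fun τ => τ i))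
    -- payoffs: bounded, jointly measurable, continuous in actions
    (u : ∀ _ : Fin n, (∀ j, A j) → (∀ j, T j) → ℝ)
    (hubdd : ∃ M : ℝ, ∀ i a t, |u i a t| ≤ M)
    (humeas : ∀ i, Measurable fun p : (∀ j, A j) × (∀ j, T j) => u i p.1 p.2)
    (hucont : ∀ i t, Continuous fun a => u i a t)
    -- a version of the conditional distribution of the type profile given one's own type
    (cond : ∀ i, T i → Measure (∀ j, T j))
    (hcondprob : ∀ i t, IsProbabilityMeasure (cond i t))
    (hcondmeas : ∀ i (e : Set (∀ j, T j)), MeasurableSet e → Measurable fun t => cond i t e)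
    (hconddis : ∀ i (e : Set (∀ j, T j)), MeasurableSet e →
      ∫⁻ τ, cond i (τ i) e ∂prior = prior e)
    -- a perfect monotone equilibrium
    (g : ∀ i, T i → A i) (hgmeas : ∀ i, Measurable (g i)) (hgmono : ∀ i, Monotone (g i))
    (hBNE : IsBNE u cond prior g) (hperfect : IsPerfect u cond prior g) :
    -- limit admissibility: almost every equilibrium action is a limit of undominated actions
    ∀ i, ∀ᵐ t ∂(prior.map fun τ => τ i),
      ∃ seq : ℕ → A i, (∀ k, ¬ WeaklyDominated u cond i (seq k) t) ∧
        Tendsto seq atTop (nhds (g i t)) := by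
  obtain ⟨M, hM⟩ := hubdd
  obtain ⟨gk, hmix, hcm, hlim⟩ := hperfect
  intro i
  filter_upwards [hlim i] with t ht
  have : Nonempty (A i) := ⟨g i t⟩
  have hne : ∀ k, (BR u cond i t (gk k)).Nonempty := fun k =>
    BR_nonempty u hM humeas hucont cond hcondprob (gk k) (hmix k) i t
  have hex : ∀ k : ℕ, ∃ b ∈ BR u cond i t (gk k),
      dist (g i t) b < infDist (g i t) (BR u cond i t (gk k)) + 1 / ((k : ℝ) + 1) := fun k =>
    (infDist_lt_iff (hne k)).1 (lt_add_of_pos_right _ (by positivity))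
  choose b hb hbd using hex
  refine ⟨b, fun k => undominated_of_BR u hM humeas hucont cond hcondprob (gk k) (hmix k) (hcm k)
    i t (b k) (hb k), ?_⟩
  rw [tendsto_iff_dist_tendsto_zero]
  have hz := ht.2.add tendsto_one_div_add_atTop_nhds_zero_nat
  rw [add_zero] at hz
  refine squeeze_zero (fun k => dist_nonneg) (fun k => ?_) hz
  rw [dist_comm]
  exact (hbd k).le

end

end MonotonePerfection
end

section
/- Suppose that for each player i the action space A_i is a compact metric space and the payoff u_i(a, t) is bounded, jointly measurable, and continuous in a for each t. If an action a_i ∈ A_i is a best response against a completely mixed strategy profile α̂_{-i} at some type t_i ∈ T_i, i.e. V_i(a_i, t_i; α̂_{-i}) ≥ V_i(a_i', t_i; α̂_{-i}) for all a_i' ∈ A_i, then a_i is undominated at type t_i. -/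
/-!
Statement 8 (Lemma `lem-undominated against completely mixed strategies`): If an action is a
best response against a completely mixed strategy profile at some type, then it is undominated
at that type.
-/

open MeasureTheory Filter Metric

namespace MonotonePerfection

noncomputable section

variable {n : ℕ} {A : Fin n → Type*} {T : Fin n → Type*}

section Helpers

open MeasureTheory ProbabilityTheory Filter

lemma aux_integrable {X : Type*} [MeasurableSpace X] (μ : Measure X) [IsFiniteMeasure μ]
    (φ : X → ℝ) (hφ : Measurable φ) (M : ℝ) (hM : ∀ x, |φ x| ≤ M) : Integrable φ μ :=
  Integrable.of_bound hφ.aestronglyMeasurable M (Eventually.of_forall hM)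

lemma aux_abs_integral_le {X : Type*} [MeasurableSpace X] (μ : Measure X) [IsProbabilityMeasure μ]
    (φ : X → ℝ) (M : ℝ) (hM : ∀ x, |φ x| ≤ M) : |∫ x, φ x ∂μ| ≤ M := by
  have := norm_integral_le_of_norm_le_const (μ := μ) (f := φ) (C := M) (Eventually.of_forall hM)
  simpa using this

/-- Perturbing a Markov kernel `κ` away from the weight `k`. -/
lemma aux_perturb {Z X : Type*} [MeasurableSpace Z] [MeasurableSpace X]
    (κ : Kernel Z X) [IsMarkovKernel κ] (k : Z → X → ℝ) (hk : Measurable (Function.uncurry k))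
    (hk0 : ∀ z x, 0 ≤ k z x) (hk1 : ∀ z x, k z x ≤ 1) (δ : ℝ) (hδ : 0 < δ) :
    ∃ G : Kernel Z X, IsMarkovKernel G ∧ ∀ z (φ : X → ℝ) (M : ℝ), Measurable φ →
      (∀ x, |φ x| ≤ M) →
      ∫ x, φ x ∂(G z) = ∫ x, φ x ∂(κ z) + min δ 1 *
        (((∫ x, k z x ∂(κ z)) * ∫ x, φ x ∂(κ z) - ∫ x, k z x * φ x ∂(κ z)) /
          max (∫ x, k z x ∂(κ z)) δ) := by
  set v : Z → ℝ := fun z => ∫ x, k z x ∂(κ z) with hv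
  have hvm : Measurable v := (hk.stronglyMeasurable.integral_kernel_prod_right (κ := κ)).measurable
  have hv0 : ∀ z, 0 ≤ v z := fun z => integral_nonneg (hk0 z)
  set w : Z → ℝ := fun z => min δ 1 / max (v z) δ with hw
  have hwm : Measurable w := by fun_prop
  have hw0 : ∀ z, 0 ≤ w z := fun z => by simp only [hw]; positivity
  have hw1 : ∀ z, w z ≤ 1 := fun z => by
    simp only [hw]
    rw [div_le_one (by positivity)]
    exact (min_le_left _ _).trans (le_max_right _ _)
  have hkm : ∀ z, Measurable (k z) := fun z => hk.comp measurable_prodMk_left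
  have hkabs : ∀ z x, |k z x| ≤ 1 := fun z x => by rw [abs_of_nonneg (hk0 z x)]; exact hk1 z x
  have hki : ∀ z, Integrable (k z) (κ z) := fun z => aux_integrable _ _ (hkm z) 1 (hkabs z)
  set d : Z → X → ℝ := fun z x => 1 + w z * (v z - k z x) with hd
  have hdm : Measurable (Function.uncurry d) := by
    have : Function.uncurry d = fun p : Z × X => 1 + w p.1 * (v p.1 - Function.uncurry k p) := rfl
    rw [this]; fun_prop
  have hd0 : ∀ z x, 0 ≤ d z x := fun z x => by
    simp only [hd]
    have h1 := hw0 z; have h2 := hw1 z; have h3 := hv0 z; have h4 := hk0 z x; have h5 := hk1 z x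
    nlinarith [mul_nonneg h1 h3, mul_nonneg h1 (sub_nonneg.2 h5)]
  have hdm' : Measurable (Function.uncurry fun z x => ENNReal.ofReal (d z x)) :=
    ENNReal.measurable_ofReal.comp hdm
  have hdi : ∀ z, Integrable (d z) (κ z) := fun z =>
    (integrable_const _).add (((integrable_const _).sub (hki z)).const_mul _)
  have hG : ∀ z, (κ.withDensity fun z x => ENNReal.ofReal (d z x)) z =
      (κ z).withDensity fun x => ENNReal.ofReal (d z x) := fun z =>
    Kernel.withDensity_apply κ hdm' z
  refine ⟨κ.withDensity fun z x => ENNReal.ofReal (d z x), ⟨fun z => ⟨?_⟩⟩, ?_⟩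
  · rw [hG, withDensity_apply _ MeasurableSet.univ, Measure.restrict_univ,
      ← ofReal_integral_eq_lintegral_ofReal (hdi z) (Eventually.of_forall (hd0 z))]
    have : ∫ x, d z x ∂(κ z) = 1 := by
      simp only [hd]
      have i1 : Integrable (fun x => v z - k z x) (κ z) := (integrable_const _).sub (hki z)
      rw [integral_add (integrable_const _) (i1.const_mul _),
        integral_const_mul, integral_sub (integrable_const _) (hki z)]
      simp [hv]
    rw [this]; simp
  · intro z φ M hφ hM
    have hφi : Integrable φ (κ z) := aux_integrable _ _ hφ M hM
    have hkφi : Integrable (fun x => k z x * φ x) (κ z) := by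
      refine aux_integrable _ _ ((hkm z).mul hφ) M fun x => ?_
      rw [abs_mul]
      calc |k z x| * |φ x| ≤ 1 * M :=
            mul_le_mul (hkabs z x) (hM x) (abs_nonneg _) zero_le_one
        _ = M := one_mul _
    have hdz : Measurable fun x => ENNReal.ofReal (d z x) := hdm'.comp measurable_prodMk_left
    rw [hG, integral_withDensity_eq_integral_toReal_smul hdz (Eventually.of_forall fun x => ENNReal.ofReal_lt_top)]
    have : ∀ x, (ENNReal.ofReal (d z x)).toReal • φ x =
        φ x + w z * (v z * φ x - k z x * φ x) := fun x => by
      rw [ENNReal.toReal_ofReal (hd0 z x)]; simp only [hd, smul_eq_mul]; ring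
    simp_rw [this]
    have i1 : Integrable (fun x => v z * φ x - k z x * φ x) (κ z) := (hφi.const_mul _).sub hkφi
    rw [integral_add hφi (i1.const_mul _),
        integral_const_mul, integral_sub (hφi.const_mul _) hkφi, integral_const_mul]
    simp only [hw, hv]; ring

/-- The one-player step. -/
lemma aux_step {S X Y : Type*} [MeasurableSpace S] [MeasurableSpace Y]
    [MetricSpace X] [CompactSpace X] [MeasurableSpace X] [BorelSpace X]
    (μ : Measure S) [IsProbabilityMeasure μ] (p : S → Y) (hp : Measurable p)
    (Ψ : X → S → ℝ) (hΨ : Measurable fun q : S × X => Ψ q.2 q.1) (M : ℝ)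
    (hM : ∀ x s, |Ψ x s| ≤ M) (hc : ∀ s, Continuous fun x => Ψ x s)
    (α : Kernel Y X) [IsMarkovKernel α]
    (hα : ∀ y (O : Set X), IsOpen O → O.Nonempty → 0 < α y O)
    (hpos : ∀ γ : Kernel Y X, IsMarkovKernel γ → 0 ≤ ∫ s, ∫ x, Ψ x s ∂(γ (p s)) ∂μ)
    (h0 : ∫ s, ∫ x, Ψ x s ∂(α (p s)) ∂μ ≤ 0)
    (h : Kernel Y X) [IsMarkovKernel h] :
    ∫ s, ∫ x, Ψ x s ∂(h (p s)) ∂μ ≤ 0 := by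
  classical
  have hΨs : ∀ s, Measurable fun x => Ψ x s := fun s => (hc s).measurable
  set a : S → ℝ := fun s => ∫ x, Ψ x s ∂(α (p s)) with ha
  have ham : Measurable a :=
    (hΨ.stronglyMeasurable.integral_kernel_prod_right' (κ := α.comap p hp)).measurable
  have haM : ∀ s, |a s| ≤ M := fun s => aux_abs_integral_le _ _ M fun x => hM x s
  have hai : Integrable a μ := aux_integrable _ _ ham M haM
  -- everything lives on `Q`
  set Q : Measure (S × X) := μ ⊗ₘ (h.comap p hp) with hQ
  have hQint : ∀ (f : S × X → ℝ) (C : ℝ), Measurable f → (∀ q, |f q| ≤ C) →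
      ∫ q, f q ∂Q = ∫ s, ∫ x, f (s, x) ∂(h (p s)) ∂μ := fun f C hf hC => by
    rw [hQ, Measure.integral_compProd (aux_integrable _ _ hf C hC)]
    rfl
  -- the weights
  let k : ℝ → X → X → ℝ := fun ε x x' => if dist x' x < ε then 1 else 0
  have hkm : ∀ ε, Measurable fun q : X × X => k ε q.1 q.2 := fun ε =>
    Measurable.ite (measurableSet_lt (measurable_snd.dist measurable_fst) measurable_const)
      measurable_const measurable_const
  have hk0 : ∀ ε x x', 0 ≤ k ε x x' := fun ε x x' => by simp only [k]; split_ifs <;> norm_num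
  have hk1 : ∀ ε x x', k ε x x' ≤ 1 := fun ε x x' => by simp only [k]; split_ifs <;> norm_num
  have hkabs : ∀ ε x x', |k ε x x'| ≤ 1 := fun ε x x' => by
    rw [abs_of_nonneg (hk0 _ _ _)]; exact hk1 _ _ _
  let v : ℝ → S × X → ℝ := fun ε q => ∫ x', k ε q.2 x' ∂(α (p q.1))
  let r : ℝ → S × X → ℝ := fun ε q => ∫ x', k ε q.2 x' * Ψ x' q.1 ∂(α (p q.1))
  let αc : Kernel (S × X) X := α.comap (fun q => p q.1) (hp.comp measurable_fst)
  have hvm : ∀ ε, Measurable (v ε) := fun ε => by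
    have : Measurable fun z : (S × X) × X => k ε z.1.2 z.2 :=
      (hkm ε).comp (g := fun q : X × X => k ε q.1 q.2)
        (f := fun z : (S × X) × X => (z.1.2, z.2)) (by fun_prop)
    exact (this.stronglyMeasurable.integral_kernel_prod_right' (κ := αc)).measurable
  have hrm : ∀ ε, Measurable (r ε) := fun ε => by
    have h1 : Measurable fun z : (S × X) × X => k ε z.1.2 z.2 :=
      (hkm ε).comp (g := fun q : X × X => k ε q.1 q.2)
        (f := fun z : (S × X) × X => (z.1.2, z.2)) (by fun_prop)
    have h2 : Measurable fun z : (S × X) × X => Ψ z.2 z.1.1 :=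
      hΨ.comp (g := fun q : S × X => Ψ q.2 q.1)
        (f := fun z : (S × X) × X => (z.1.1, z.2)) (by fun_prop)
    exact ((h1.mul h2).stronglyMeasurable.integral_kernel_prod_right' (κ := αc)).measurable
  have hki : ∀ ε x y, Integrable (k ε x) (α y) := fun ε x y =>
    aux_integrable _ _ ((hkm ε).comp (g := fun q : X × X => k ε q.1 q.2)
      (f := fun x' => (x, x')) (by fun_prop)) 1 (hkabs ε x)
  have hkΨi : ∀ ε x y s, Integrable (fun x' => k ε x x' * Ψ x' s) (α y) := fun ε x y s => by
    refine (aux_integrable _ _ (hΨs s) M fun x => hM x s).bdd_mul (c := 1)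
      (hki ε x y).aestronglyMeasurable (Eventually.of_forall (hkabs ε x))
  have hv : ∀ ε, 0 < ε → ∀ q, 0 < v ε q := fun ε hε q => by
    have : v ε q = (α (p q.1)).real (Metric.ball q.2 ε) := by
      rw [← integral_indicator_one Metric.isOpen_ball.measurableSet]
      refine integral_congr_ae (Eventually.of_forall fun x' => ?_)
      simp [k, Set.indicator_apply]
    rw [this]
    exact ENNReal.toReal_pos (hα _ _ Metric.isOpen_ball ⟨q.2, Metric.mem_ball_self hε⟩).ne'
      (measure_ne_top _ _)
  have hkΨ : ∀ ε x y s b η, (∀ x', dist x' x < ε → |Ψ x' s - b| ≤ η) →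
      |∫ x', k ε x x' * Ψ x' s ∂(α y) - (∫ x', k ε x x' ∂(α y)) * b| ≤
        (∫ x', k ε x x' ∂(α y)) * η := fun ε x y s b η hb => by
    rw [← integral_mul_const b (k ε x), ← integral_mul_const η (k ε x),
      ← integral_sub (hkΨi ε x y s) ((hki ε x y).mul_const b)]
    rw [← Real.norm_eq_abs]
    refine norm_integral_le_of_norm_le ((hki ε x y).mul_const η) (Eventually.of_forall fun x' => ?_)
    rw [← mul_sub, norm_mul, Real.norm_of_nonneg (hk0 _ _ _)]
    by_cases hx : dist x' x < ε
    · exact mul_le_mul_of_nonneg_left (hb x' hx) (hk0 _ _ _)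
    · simp [k, hx]
  have hrM : ∀ ε q, |r ε q| ≤ v ε q * M := fun ε q => by
    have := hkΨ ε q.2 (p q.1) q.1 0 M (fun x' _ => by simpa using hM x' q.1)
    simpa using this
  have hvnn : ∀ ε q, 0 ≤ v ε q := fun ε q => integral_nonneg (hk0 ε q.2)
  have hD : ∀ ε q, |v ε q * a q.1 - r ε q| ≤ v ε q * (2 * M) := fun ε q => by
    have h1 := hrM ε q
    have h2 : |v ε q * a q.1| ≤ v ε q * M := by
      rw [abs_mul, abs_of_nonneg (hvnn ε q)]
      exact mul_le_mul_of_nonneg_left (haM _) (hvnn ε q)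
    have := abs_sub (v ε q * a q.1) (r ε q)
    linarith
  have hM0 : ∀ q : S × X, 0 ≤ M := fun q => (abs_nonneg _).trans (haM q.1)
  -- first inequality
  have key1 : ∀ ε δ, 0 < δ → 0 ≤ ∫ q, (v ε q * a q.1 - r ε q) / max (v ε q) δ ∂Q := by
    intro ε δ hδ
    obtain ⟨G, hGM, hG⟩ := aux_perturb (α.comap (Prod.fst : Y × X → Y) measurable_fst)
      (fun z x' => k ε z.2 x')
      ((hkm ε).comp (g := fun q : X × X => k ε q.1 q.2)
        (f := fun z : (Y × X) × X => (z.1.2, z.2)) (by fun_prop))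
      (fun z x => hk0 _ _ _) (fun z x => hk1 _ _ _) δ hδ
    have hpos' := hpos (h ⊗ₖ G).snd inferInstance
    have hb : ∀ q, |(v ε q * a q.1 - r ε q) / max (v ε q) δ| ≤ 2 * M := fun q => by
      have : 0 < max (v ε q) δ := lt_max_of_lt_right hδ
      rw [abs_div, abs_of_pos this, div_le_iff₀ this]
      refine (hD ε q).trans ?_
      rw [mul_comm]
      exact mul_le_mul_of_nonneg_left (le_max_left _ _) (by linarith [hM0 q])
    have hm : Measurable fun q => (v ε q * a q.1 - r ε q) / max (v ε q) δ :=
      (((hvm ε).mul (ham.comp measurable_fst)).sub (hrm ε)).div ((hvm ε).max measurable_const)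
    have e1 : ∀ s, ∫ x, Ψ x s ∂((h ⊗ₖ G).snd (p s)) =
        a s + min δ 1 * ∫ x, (v ε (s, x) * a s - r ε (s, x)) / max (v ε (s, x)) δ ∂(h (p s)) := by
      intro s
      have i0 : Integrable (fun z : X × X => Ψ z.2 s) ((h ⊗ₖ G) (p s)) :=
        aux_integrable _ _ ((hΨs s).comp measurable_snd) M fun x => hM _ s
      rw [Kernel.snd_apply, integral_map measurable_snd.aemeasurable
        (hΨs s).aestronglyMeasurable, ProbabilityTheory.integral_compProd i0]
      have : ∀ x, ∫ x', Ψ x' s ∂(G (p s, x)) =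
          a s + min δ 1 * ((v ε (s, x) * a s - r ε (s, x)) / max (v ε (s, x)) δ) := fun x =>
        hG (p s, x) (fun x' => Ψ x' s) M (hΨs s) (fun x => hM x s)
      simp only [this]
      have hi : Integrable (fun x => (v ε (s, x) * a s - r ε (s, x)) / max (v ε (s, x)) δ)
          (h (p s)) :=
        aux_integrable _ _ (hm.comp (measurable_prodMk_left (x := s))) (2 * M) fun x => hb (s, x)
      rw [integral_add (integrable_const _) (hi.const_mul _), integral_const_mul]
      simp
    simp only [e1] at hpos'
    have hi2 : Integrable (fun s => ∫ x, (v ε (s, x) * a s - r ε (s, x)) / max (v ε (s, x)) δ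
        ∂(h (p s))) μ :=
      aux_integrable _ _ (hm.stronglyMeasurable.integral_kernel_prod_right'
        (κ := h.comap p hp)).measurable (2 * M)
        fun s => aux_abs_integral_le _ _ _ fun x => hb (s, x)
    rw [integral_add hai (hi2.const_mul _), integral_const_mul, ← hQint _ (2 * M) hm hb] at hpos'
    have hmin : 0 < min δ 1 := by positivity
    have : 0 ≤ min δ 1 * ∫ q, (v ε q * a q.1 - r ε q) / max (v ε q) δ ∂Q := by linarith
    exact nonneg_of_mul_nonneg_right this hmin
  have hseq : Tendsto (fun m : ℕ => 1 / ((m : ℝ) + 1)) atTop (nhds 0) :=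
    tendsto_one_div_add_atTop_nhds_zero_nat
  have hseq0 : ∀ m : ℕ, 0 < 1 / ((m : ℝ) + 1) := fun m => by positivity
  have hnum : ∀ ε, Measurable fun q => v ε q * a q.1 - r ε q := fun ε =>
    ((hvm ε).mul (ham.comp measurable_fst)).sub (hrm ε)
  have key2 : ∀ ε, 0 < ε → 0 ≤ ∫ q, (v ε q * a q.1 - r ε q) / v ε q ∂Q := by
    intro ε hε
    refine ge_of_tendsto' (tendsto_integral_of_dominated_convergence (fun _ => 2 * M)
      (F := fun (m : ℕ) q => (v ε q * a q.1 - r ε q) / max (v ε q) (1 / ((m : ℝ) + 1)))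
      (fun m => ((hnum ε).div ((hvm ε).max measurable_const)).aestronglyMeasurable)
      (integrable_const _) (fun m => Eventually.of_forall fun q => ?_)
      (Eventually.of_forall fun q => ?_)) (fun m => key1 ε _ (hseq0 m))
    · have : 0 < max (v ε q) (1 / ((m : ℝ) + 1)) := lt_max_of_lt_right (hseq0 m)
      rw [Real.norm_eq_abs, abs_div, abs_of_pos this, div_le_iff₀ this]
      refine (hD ε q).trans ?_
      rw [mul_comm]
      exact mul_le_mul_of_nonneg_left (le_max_left _ _) (by linarith [hM0 q])
    · have : Tendsto (fun m : ℕ => max (v ε q) (1 / ((m : ℝ) + 1))) atTop (nhds (v ε q)) := by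
        have := (tendsto_const_nhds (x := v ε q)).max hseq
        rwa [max_eq_left (hvnn ε q)] at this
      exact tendsto_const_nhds.div this (hv ε hε q).ne'
  have key3 : 0 ≤ ∫ q, (a q.1 - Ψ q.2 q.1) ∂Q := by
    refine ge_of_tendsto' (tendsto_integral_of_dominated_convergence (fun _ => 2 * M)
      (F := fun (m : ℕ) q => (v (1 / ((m : ℝ) + 1)) q * a q.1 - r (1 / ((m : ℝ) + 1)) q) /
        v (1 / ((m : ℝ) + 1)) q)
      (fun m => ((hnum _).div (hvm _)).aestronglyMeasurable)
      (integrable_const _) (fun m => Eventually.of_forall fun q => ?_)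
      (Eventually.of_forall fun q => ?_)) (fun m => key2 _ (hseq0 m))
    · have := hv _ (hseq0 m) q
      rw [Real.norm_eq_abs, abs_div, abs_of_pos this, div_le_iff₀ this, mul_comm (2 * M)]
      exact hD _ q
    · rw [Metric.tendsto_atTop]
      intro η hη
      obtain ⟨ρ, hρ, hρ'⟩ := Metric.continuous_iff.1 (hc q.1) q.2 (η / 2) (half_pos hη)
      obtain ⟨N, hN⟩ := (Metric.tendsto_atTop.1 hseq) ρ hρ
      refine ⟨N, fun m hm => ?_⟩
      have hmρ := hN m hm
      rw [Real.dist_0_eq_abs, abs_of_pos (hseq0 m)] at hmρ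
      have hε0 := hseq0 m
      generalize 1 / ((m : ℝ) + 1) = ε at hmρ hε0
      have hvp := hv ε hε0 q
      have h1 : |r ε q - v ε q * Ψ q.2 q.1| ≤ v ε q * (η / 2) :=
        hkΨ ε q.2 (p q.1) q.1 (Ψ q.2 q.1) (η / 2) fun x' hx' => (hρ' x' (hx'.trans hmρ)).le
      have h2 : (v ε q * a q.1 - r ε q) / v ε q - (a q.1 - Ψ q.2 q.1) =
          -((r ε q - v ε q * Ψ q.2 q.1) / v ε q) := by field_simp; ring
      rw [Real.dist_eq, h2, abs_neg, abs_div, abs_of_pos hvp, div_lt_iff₀ hvp]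
      nlinarith
  have e2 : ∫ q, (a q.1 - Ψ q.2 q.1) ∂Q = ∫ s, a s ∂μ - ∫ s, ∫ x, Ψ x s ∂(h (p s)) ∂μ := by
    have i1 : Integrable (fun q : S × X => a q.1) Q :=
      aux_integrable _ _ (ham.comp measurable_fst) M fun q => haM _
    have i2 : Integrable (fun q : S × X => Ψ q.2 q.1) Q :=
      aux_integrable _ _ hΨ M fun q => hM _ _
    rw [integral_sub i1 i2, hQint (fun q => a q.1) M (ham.comp measurable_fst) (fun q => haM _),
      hQint _ M hΨ fun q => hM _ _]
    simp
  linarith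

/-- The product measures form a kernel. -/
lemma aux_measurable_pi {n : ℕ} {A T : Fin n → Type*}
    [∀ i, MeasurableSpace (A i)] [∀ i, MeasurableSpace (T i)]
    (g : ∀ j, Kernel (T j) (A j)) (hg : ∀ j, IsMarkovKernel (g j)) :
    Measurable fun s : ∀ j, T j => Measure.pi fun j => g j (s j) := by
  refine Measurable.measure_of_isPiSystem_of_isProbabilityMeasure generateFrom_pi.symm
    isPiSystem_pi ?_
  rintro _ ⟨B, hB, rfl⟩
  simp only [Measure.pi_pi]
  refine Finset.measurable_prod _ fun j _ => ?_
  exact ((g j).measurable_coe (hB j (Set.mem_univ _))).comp (measurable_pi_apply j)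

lemma aux_pi_update {n : ℕ} {A : Fin n → Type*} [∀ i, MeasurableSpace (A i)]
    (μ : ∀ j, Measure (A j)) [∀ j, IsProbabilityMeasure (μ j)] (j : Fin n)
    (ν : Measure (A j)) [IsProbabilityMeasure ν] :
    Measure.pi (Function.update μ j ν) =
      (ν.prod (Measure.pi μ)).map fun p => Function.update p.2 j p.1 := by
  have hm : Measurable fun p : A j × (∀ k, A k) => Function.update p.2 j p.1 :=
    measurable_update'.comp measurable_swap
  have : ∀ k, IsProbabilityMeasure (Function.update μ j ν k) := fun k => by
    by_cases h : k = j
    · subst h; simpa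
    · rw [Function.update_of_ne h]; infer_instance
  refine Measure.pi_eq fun B hB => ?_
  rw [Measure.map_apply hm (MeasurableSet.univ_pi hB)]
  have : (fun p : A j × (∀ k, A k) => Function.update p.2 j p.1) ⁻¹' Set.univ.pi B =
      B j ×ˢ Set.univ.pi (Function.update B j Set.univ) := by
    ext ⟨x, b⟩
    simp only [Set.mem_preimage, Set.mem_pi, Set.mem_univ, true_imp_iff, Set.mem_prod]
    constructor
    · intro h
      refine ⟨by simpa using h j, fun k => ?_⟩
      by_cases hk : k = j
      · subst hk; simp
      · simpa [hk] using h k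
    · rintro ⟨h1, h2⟩ k
      by_cases hk : k = j
      · subst hk; simpa using h1
      · simpa [hk] using h2 k
  rw [this, Measure.prod_prod, Measure.pi_pi,
    ← Finset.mul_prod_erase Finset.univ _ (Finset.mem_univ j),
    ← Finset.mul_prod_erase Finset.univ (fun k => Function.update μ j ν k (B k))
      (Finset.mem_univ j)]
  simp only [Function.update_self, measure_univ, one_mul]
  congr 1
  refine Finset.prod_congr rfl fun k hk => ?_
  have := Finset.ne_of_mem_erase hk
  simp [this]

/-- Replacing strategies one at a time. -/
lemma aux_induct {n : ℕ} {A T : Fin n → Type*}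
    [∀ i, MetricSpace (A i)] [∀ i, CompactSpace (A i)]
    [∀ i, MeasurableSpace (A i)] [∀ i, BorelSpace (A i)] [∀ i, MeasurableSpace (T i)]
    (μ : Measure (∀ j, T j)) [IsProbabilityMeasure μ]
    (f : (∀ j, A j) → (∀ j, T j) → ℝ)
    (hf : Measurable fun q : (∀ j, A j) × (∀ j, T j) => f q.1 q.2) (M : ℝ)
    (hM : ∀ b s, |f b s| ≤ M) (hc : ∀ s, Continuous fun b => f b s)
    (α : ∀ j, Kernel (T j) (A j)) (hαM : ∀ j, IsMarkovKernel (α j))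
    (hα : ∀ j y (O : Set (A j)), IsOpen O → O.Nonempty → 0 < α j y O)
    (hpos : ∀ γ : ∀ j, Kernel (T j) (A j), (∀ j, IsMarkovKernel (γ j)) →
      0 ≤ ∫ s, ∫ b, f b s ∂(Measure.pi fun j => γ j (s j)) ∂μ)
    (h0 : ∫ s, ∫ b, f b s ∂(Measure.pi fun j => α j (s j)) ∂μ ≤ 0)
    (g : ∀ j, Kernel (T j) (A j)) (hgM : ∀ j, IsMarkovKernel (g j)) :
    ∫ s, ∫ b, f b s ∂(Measure.pi fun j => g j (s j)) ∂μ ≤ 0 := by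
  classical
  suffices H : ∀ F : Finset (Fin n),
      ∫ s, ∫ b, f b s ∂(Measure.pi fun j => F.piecewise g α j (s j)) ∂μ ≤ 0 by
    simpa using H Finset.univ
  intro F
  induction F using Finset.induction_on with
  | empty => simpa using h0
  | insert j F hj ih =>
    rw [Finset.piecewise_insert]
    have hGj : F.piecewise g α j = α j := Finset.piecewise_eq_of_notMem _ _ _ hj
    have hGM : ∀ k, IsMarkovKernel (F.piecewise g α k) := fun k => by
      by_cases h : k ∈ F
      · rw [Finset.piecewise_eq_of_mem _ _ _ h]; exact hgM k
      · rw [Finset.piecewise_eq_of_notMem _ _ _ h]; exact hαM k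
    generalize F.piecewise g α = G at *
    let κ : Kernel (∀ k, T k) (∀ k, A k) :=
      ⟨fun s => Measure.pi fun k => G k (s k), aux_measurable_pi G hGM⟩
    have hκ : IsMarkovKernel κ := ⟨fun s => by
      change IsProbabilityMeasure (Measure.pi fun k => G k (s k)); infer_instance⟩
    let Ψ : A j → (∀ k, T k) → ℝ := fun x s => ∫ b, f (Function.update b j x) s ∂(κ s)
    have hfs : ∀ s, Measurable fun b => f b s := fun s =>
      hf.comp (g := fun q : (∀ j, A j) × (∀ j, T j) => f q.1 q.2) (f := fun b => (b, s))
        (by fun_prop)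
    have hfj : Measurable fun z : ((∀ k, T k) × A j) × (∀ k, A k) =>
        f (Function.update z.2 j z.1.2) z.1.1 := by
      have h1 : Measurable fun z : ((∀ k, T k) × A j) × (∀ k, A k) =>
          Function.update z.2 j z.1.2 :=
        measurable_update'.comp (f := fun z : ((∀ k, T k) × A j) × (∀ k, A k) => (z.2, z.1.2))
          (by fun_prop)
      exact hf.comp (h1.prodMk (measurable_fst.comp measurable_fst))
    have hL : ∀ h : Kernel (T j) (A j), IsMarkovKernel h → ∀ s : ∀ k, T k,
        ∫ b, f b s ∂(Measure.pi fun k => Function.update G j h k (s k)) =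
          ∫ x, Ψ x s ∂(h (s j)) := by
      intro h hh s
      have e : (fun k => Function.update G j h k (s k)) =
          Function.update (fun k => G k (s k)) j (h (s j)) := by
        funext k
        by_cases hk : k = j
        · subst hk; simp
        · simp [hk]
      have hm : Measurable fun p : A j × (∀ k, A k) => Function.update p.2 j p.1 :=
        measurable_update'.comp measurable_swap
      have i0 : Integrable (fun p : A j × (∀ k, A k) => f (Function.update p.2 j p.1) s)
          ((h (s j)).prod (Measure.pi fun k => G k (s k))) :=
        aux_integrable _ _ ((hfs s).comp hm) M fun x => hM _ _
      rw [e, aux_pi_update, integral_map hm.aemeasurable (hfs s).aestronglyMeasurable,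
        integral_prod _ i0]
      rfl
    have key := aux_step μ (fun s => s j) (measurable_pi_apply j) Ψ
      (hfj.stronglyMeasurable.integral_kernel_prod_right'
        (κ := κ.comap Prod.fst measurable_fst)).measurable M
      (fun x s => aux_abs_integral_le _ _ M fun b => hM _ _)
      (fun s => continuous_of_dominated (bound := fun _ => M)
        (fun x => (hfj.comp (measurable_prodMk_left (x := (s, x)))).aestronglyMeasurable)
        (fun x => Eventually.of_forall fun b => hM _ _) (integrable_const _)
        (Eventually.of_forall fun b => (hc s).comp (continuous_const.update j continuous_id)))
      (α j) (hα j)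
      (fun γ hγ => by
        have := hpos (Function.update G j γ) (fun k => by
          by_cases hk : k = j
          · subst hk; simpa
          · simpa [hk] using hGM k)
        simpa only [hL γ hγ] using this)
      (by
        have := hL (α j) (hαM j)
        simp only [← this]
        rw [← hGj, Function.update_eq_self]
        exact ih)
      (g j)
    simpa only [hL (g j) (hgM j)] using key

end Helpers

open ProbabilityTheory in
/-- **Lemma.**  Suppose each action space is a compact metric space and each payoff is bounded,
jointly measurable, and continuous in the action profile.  If an action `a` of player `i` is a
best response at type `t` against a completely mixed strategy profile `α̂`, then `a` is
undominated at `t`. -/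
theorem not_weaklyDominated_of_bestResponse_completelyMixed
    {n : ℕ} (hn : 2 ≤ n)
    (A : Fin n → Type*) (T : Fin n → Type*)
    [∀ i, MetricSpace (A i)] [∀ i, CompactSpace (A i)]
    [∀ i, MeasurableSpace (A i)] [∀ i, BorelSpace (A i)]
    [∀ i, MeasurableSpace (T i)]
    -- the common prior
    (prior : Measure (∀ j, T j)) [IsProbabilityMeasure prior]
    -- payoffs: bounded, jointly measurable, continuous in actions
    (u : ∀ _ : Fin n, (∀ j, A j) → (∀ j, T j) → ℝ)
    (hubdd : ∃ M : ℝ, ∀ i a t, |u i a t| ≤ M)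
    (humeas : ∀ i, Measurable fun p : (∀ j, A j) × (∀ j, T j) => u i p.1 p.2)
    (hucont : ∀ i t, Continuous fun a => u i a t)
    -- a version of the conditional distribution of the type profile given one's own type
    (cond : ∀ i, T i → Measure (∀ j, T j))
    (hcondprob : ∀ i t, IsProbabilityMeasure (cond i t))
    (hcondmeas : ∀ i (e : Set (∀ j, T j)), MeasurableSet e → Measurable fun t => cond i t e)
    (hconddis : ∀ i (e : Set (∀ j, T j)), MeasurableSet e →
      ∫⁻ τ, cond i (τ i) e ∂prior = prior e)
    -- a completely mixed strategy profile
    (α : ∀ j, T j → Measure (A j))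
    (hαmixed : ∀ j, IsMixedStrategy (α j)) (hαcm : CompletelyMixed α)
    -- an action that is a best response against it at some type
    (i : Fin n) (a : A i) (t : T i)
    (hBR : ∀ a' : A i, interim u cond i a' t α ≤ interim u cond i a t α) :
    ¬ WeaklyDominated u cond i a t := by
  classical
  rintro ⟨σ, hσ, hdom, ĝ, hĝ, hlt⟩
  obtain ⟨M, hM⟩ := hubdd
  have hcp := hcondprob i t
  -- mixed strategies as kernels
  let K : ∀ g : ∀ j, T j → Measure (A j), (∀ j, IsMixedStrategy (g j)) →
      ∀ j, Kernel (T j) (A j) := fun g hg j =>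
    ⟨g j, Measure.measurable_of_measurable_coe _ (hg j).2⟩
  have hKM : ∀ g hg j, IsMarkovKernel (K g hg j) := fun g hg j => ⟨(hg j).1⟩
  -- the payoff difference
  let w : A i → (∀ j, A j) → (∀ j, T j) → ℝ := fun x b s =>
    u i (Function.update b i x) (Function.update s i t)
  have hwM : ∀ x b s, |w x b s| ≤ M := fun x b s => hM _ _ _
  have hwm : Measurable fun z : ((∀ j, A j) × (∀ j, T j)) × A i => w z.2 z.1.1 z.1.2 := by
    have h1 : Measurable fun z : ((∀ j, A j) × (∀ j, T j)) × A i =>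
        Function.update z.1.1 i z.2 :=
      measurable_update'.comp
        (f := fun z : ((∀ j, A j) × (∀ j, T j)) × A i => (z.1.1, z.2)) (by fun_prop)
    have h2 : Measurable fun z : ((∀ j, A j) × (∀ j, T j)) × A i =>
        Function.update z.1.2 i t :=
      measurable_update'.comp
        (f := fun z : ((∀ j, A j) × (∀ j, T j)) × A i => (z.1.2, t)) (by fun_prop)
    exact (humeas i).comp (h1.prodMk h2)
  have hwmx : ∀ x, Measurable fun q : (∀ j, A j) × (∀ j, T j) => w x q.1 q.2 := fun x =>
    hwm.comp (measurable_prodMk_right (y := x))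
  have hwc : ∀ s, Continuous fun p : A i × (∀ j, A j) => w p.1 p.2 s := fun s =>
    (hucont i _).comp (continuous_snd.update i continuous_fst)
  let f1 : (∀ j, A j) → (∀ j, T j) → ℝ := fun b s => ∫ x, w x b s ∂σ
  let f : (∀ j, A j) → (∀ j, T j) → ℝ := fun b s => f1 b s - w a b s
  have hf1m : Measurable fun q : (∀ j, A j) × (∀ j, T j) => f1 q.1 q.2 :=
    (hwm.stronglyMeasurable.integral_prod_right' (ν := σ)).measurable
  have hf1M : ∀ b s, |f1 b s| ≤ M := fun b s => aux_abs_integral_le _ _ M fun x => hwM x b s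
  have hfm : Measurable fun q : (∀ j, A j) × (∀ j, T j) => f q.1 q.2 := hf1m.sub (hwmx a)
  have hfM : ∀ b s, |f b s| ≤ M + M := fun b s =>
    (abs_sub _ _).trans (add_le_add (hf1M b s) (hwM a b s))
  have hfc : ∀ s, Continuous fun b => f b s := fun s => by
    refine Continuous.sub ?_ ((hwc s).comp (continuous_const.prodMk continuous_id))
    refine continuous_of_dominated (bound := fun _ => M)
      (fun b => ((hwc s).comp (continuous_id.prodMk continuous_const)).measurable.aestronglyMeasurable)
      (fun b => Eventually.of_forall fun x => hwM _ _ _) (integrable_const _)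
      (Eventually.of_forall fun x => (hwc s).comp (continuous_const.prodMk continuous_id))
  -- the difference of interim payoffs
  have hI : ∀ g : ∀ j, T j → Measure (A j), (∀ j, IsMixedStrategy (g j)) →
      Measurable (fun x => interim u cond i x t g) ∧ (∀ x, |interim u cond i x t g| ≤ M) ∧
      ∫ s, ∫ b, f b s ∂(Measure.pi fun j => g j (s j)) ∂(cond i t) =
        ∫ x, interim u cond i x t g ∂σ - interim u cond i a t g := by
    intro g hg
    let κ : Kernel (∀ k, T k) (∀ k, A k) :=
      ⟨fun s => Measure.pi fun k => g k (s k), aux_measurable_pi (K g hg) (hKM g hg)⟩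
    have hκ : IsMarkovKernel κ := ⟨fun s => by
      have : ∀ k, IsProbabilityMeasure (g k (s k)) := fun k => (hg k).1 _
      change IsProbabilityMeasure (Measure.pi fun k => g k (s k)); infer_instance⟩
    let Q := cond i t ⊗ₘ κ
    have hQ : ∀ (φ : (∀ j, A j) → (∀ j, T j) → ℝ) (C : ℝ),
        (Measurable fun q : (∀ j, A j) × (∀ j, T j) => φ q.1 q.2) → (∀ b s, |φ b s| ≤ C) →
        Integrable (fun q : (∀ j, T j) × (∀ j, A j) => φ q.2 q.1) Q ∧
        ∫ s, ∫ b, φ b s ∂(κ s) ∂(cond i t) = ∫ q, φ q.2 q.1 ∂Q := fun φ C hφ hC => by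
      have hi : Integrable (fun q : (∀ j, T j) × (∀ j, A j) => φ q.2 q.1) Q :=
        aux_integrable _ _ (hφ.comp measurable_swap) C fun q => hC _ _
      exact ⟨hi, (Measure.integral_compProd hi).symm⟩
    have hint : ∀ x, interim u cond i x t g = ∫ q, w x q.2 q.1 ∂Q := fun x =>
      (hQ (w x) M (hwmx x) (hwM x)).2
    have hsw : Measurable fun z : A i × ((∀ j, T j) × (∀ j, A j)) => w z.1 z.2.2 z.2.1 :=
      hwm.comp (f := fun z : A i × ((∀ j, T j) × (∀ j, A j)) => ((z.2.2, z.2.1), z.1))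
        (by fun_prop)
    refine ⟨?_, ?_, ?_⟩
    · simp only [hint]
      exact (hsw.stronglyMeasurable.integral_prod_right' (ν := Q)).measurable
    · intro x
      rw [hint]
      exact aux_abs_integral_le _ _ M fun q => hwM _ _ _
    · refine (hQ f (M + M) hfm hfM).2.trans ?_
      simp only [hint]
      have i0 : Integrable (Function.uncurry fun (x : A i) (q : (∀ j, T j) × (∀ j, A j)) =>
          w x q.2 q.1) (σ.prod Q) := aux_integrable _ _ hsw M fun z => hwM _ _ _
      rw [integral_integral_swap i0]
      exact integral_sub (hQ f1 M hf1m hf1M).1 (hQ (w a) M (hwmx a) (hwM a)).1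
  have hfin := aux_induct (cond i t) f hfm (M + M) hfM hfc (K α hαmixed) (hKM α hαmixed)
    (fun j y O hO hne => hαcm j y O hO hne)
    (fun γ hγ => by
      have hm : ∀ j, IsMixedStrategy (fun y => γ j y) := fun j =>
        ⟨fun y => (hγ j).isProbabilityMeasure y, fun B hB => (γ j).measurable_coe hB⟩
      have := (hI (fun j y => γ j y) hm).2.2
      rw [this]
      linarith [hdom (fun j y => γ j y) hm])
    (by
      obtain ⟨h1, h2, h3⟩ := hI α hαmixed
      refine h3.le.trans ?_
      have : ∫ x, interim u cond i x t α ∂σ ≤ ∫ x, interim u cond i a t α ∂σ :=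
        integral_mono (aux_integrable _ _ h1 M h2) (integrable_const _) hBR
      simp at this
      linarith)
    (K ĝ hĝ) (hKM ĝ hĝ)
  have := (hI ĝ hĝ).2.2.symm.le.trans hfin
  linarith

end

end MonotonePerfection
end
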